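/- Let Ω ⊂⊂ ℂⁿ be a pseudoconvex domain with smooth boundary. For a defining function ρ of Ω write N := N_ρ; for each (1,0) tangent vector field L on ∂Ω, extended to U so that Lρ = 0 on U, set Σ_L := {p ∈ ∂Ω : L_ρ(L,L)(p) = 0}, and define η_ρ as the infimum of all η₂ ∈ (1,∞) such that for every such L the inequality (1/(η₂−1))·|L_ρ(L,N)|²/‖∇ρ‖² − (1/2)·(N L_ρ(L,L))/‖∇ρ‖ ≤ 0 holds at every point of Σ_L (η_ρ := ∞ if no such η₂ exists). Then S(Ω) equals the infimum of η_ρ over all smooth defining functions ρ of Ω. -/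

import Mathlib

noncomputable section

open Complex Topology
open scoped ENNReal

/-- Wirtinger derivative `∂f/∂z_j`. -/
def dz {n : ℕ} (j : Fin n) (f : (Fin n → ℂ) → ℂ) (z : Fin n → ℂ) : ℂ :=
  (fderiv ℝ f z (Pi.single j 1) - Complex.I * fderiv ℝ f z (Pi.single j Complex.I)) / 2

/-- Wirtinger derivative `∂f/∂z̄_j`. -/
def dzbar {n : ℕ} (j : Fin n) (f : (Fin n → ℂ) → ℂ) (z : Fin n → ℂ) : ℂ :=
  (fderiv ℝ f z (Pi.single j 1) + Complex.I * fderiv ℝ f z (Pi.single j Complex.I)) / 2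

/-- Complexification of a real-valued function. -/
def cplx {n : ℕ} (ρ : (Fin n → ℂ) → ℝ) : (Fin n → ℂ) → ℂ := fun z => (ρ z : ℂ)

/-- The Levi form `L_ρ(X,Y)(z) = Σ_{j,k} ∂²ρ/∂z_j∂z̄_k (z) X_j conj(Y_k)`. -/
def levi {n : ℕ} (ρ : (Fin n → ℂ) → ℝ) (X Y : Fin n → ℂ) (z : Fin n → ℂ) : ℂ :=
  ∑ j, ∑ k, dz j (fun w => dzbar k (cplx ρ) w) z * X j * (starRingEnd ℂ) (Y k)

/-- `Xf = Σ_j X_j ∂f/∂z_j` for a (1,0) vector `X`. -/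
def dirDeriv {n : ℕ} (X : Fin n → ℂ) (f : (Fin n → ℂ) → ℂ) (z : Fin n → ℂ) : ℂ :=
  ∑ j, X j * dz j f z

/-- `X̄f = Σ_j conj(X_j) ∂f/∂z̄_j`. -/
def dirDerivBar {n : ℕ} (X : Fin n → ℂ) (f : (Fin n → ℂ) → ℂ) (z : Fin n → ℂ) : ℂ :=
  ∑ j, (starRingEnd ℂ) (X j) * dzbar j f z

/-- Derivative of `f` along the (1,0) vector field `X`. -/
def fieldDeriv {n : ℕ} (X : (Fin n → ℂ) → (Fin n → ℂ)) (f : (Fin n → ℂ) → ℂ)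
    (z : Fin n → ℂ) : ℂ :=
  dirDeriv (X z) f z

/-- Euclidean norm of the real gradient of `ρ`. -/
def gradNorm {n : ℕ} (ρ : (Fin n → ℂ) → ℝ) (z : Fin n → ℂ) : ℝ :=
  Real.sqrt (∑ j, ((fderiv ℝ ρ z (Pi.single j 1)) ^ 2 +
    (fderiv ℝ ρ z (Pi.single j Complex.I)) ^ 2))

/-- The complex normal field `N_ρ`. -/
def nfield {n : ℕ} (ρ : (Fin n → ℂ) → ℝ) (z : Fin n → ℂ) : Fin n → ℂ := fun j =>
  ((Real.sqrt (∑ k, Complex.normSq (dz k (cplx ρ) z)) : ℝ) : ℂ)⁻¹ * dzbar j (cplx ρ) z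

/-- Squared Euclidean norm of a vector in ℂⁿ. -/
def enormSq {n : ℕ} (X : Fin n → ℂ) : ℝ := ∑ j, Complex.normSq (X j)

/-- `f` is strictly plurisubharmonic on `S`. -/
def StrictPSHOn {n : ℕ} (f : (Fin n → ℂ) → ℝ) (S : Set (Fin n → ℂ)) : Prop :=
  ∀ z ∈ S, ∀ X : Fin n → ℂ, X ≠ 0 → 0 < (levi f X X z).re

/-- `ρ` is a (global smooth) defining function of `Ω` on the neighborhood `V` of `cl Ω`. -/
structure IsDefFn {n : ℕ} (Ω V : Set (Fin n → ℂ)) (ρ : (Fin n → ℂ) → ℝ) : Prop where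
  isOpen : IsOpen V
  subset : closure Ω ⊆ V
  smooth : ContDiffOn ℝ (⊤ : ℕ∞) ρ V
  eq : Ω = {z ∈ V | ρ z < 0}
  grad_ne : ∀ z ∈ frontier Ω, fderiv ℝ ρ z ≠ 0

/-- The Levi form of `ρ` is positive semidefinite on complex tangent vectors at `z`. -/
def LeviPseudoconvexAt {n : ℕ} (ρ : (Fin n → ℂ) → ℝ) (z : Fin n → ℂ) : Prop :=
  ∀ X : Fin n → ℂ, dirDeriv X (cplx ρ) z = 0 → 0 ≤ (levi ρ X X z).re

/-- `Ω` is a (smoothly bounded, Levi) pseudoconvex domain. -/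
def IsPseudoconvex {n : ℕ} (Ω : Set (Fin n → ℂ)) : Prop :=
  ∃ (V : Set (Fin n → ℂ)) (ρ : (Fin n → ℂ) → ℝ), IsDefFn Ω V ρ ∧
    ∀ p ∈ frontier Ω, LeviPseudoconvexAt ρ p

/-- The set of Steinness exponents of `ρ`. -/
def steinExpSet {n : ℕ} (Ω : Set (Fin n → ℂ)) (ρ : (Fin n → ℂ) → ℝ) : Set ℝ :=
  {η : ℝ | 1 < η ∧ ∃ W : Set (Fin n → ℂ), IsOpen W ∧ frontier Ω ⊆ W ∧
    StrictPSHOn (fun z => ρ z ^ η) ((closure Ω)ᶜ ∩ W)}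

/-- The Steinness exponent `η̃_ρ` of a defining function `ρ` (`∞` if none exists). -/
def steinExp {n : ℕ} (Ω : Set (Fin n → ℂ)) (ρ : (Fin n → ℂ) → ℝ) : ℝ≥0∞ :=
  sInf (ENNReal.ofReal '' steinExpSet Ω ρ)

/-- The Steinness index `S(Ω)`. -/
def steinIndex {n : ℕ} (Ω : Set (Fin n → ℂ)) : ℝ≥0∞ :=
  ⨅ (V : Set (Fin n → ℂ)) (ρ : (Fin n → ℂ) → ℝ) (_ : IsDefFn Ω V ρ), steinExp Ω ρ

/-- The set of Diederich–Fornæss exponents of `ρ`. -/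
def dfExpSet {n : ℕ} (Ω : Set (Fin n → ℂ)) (ρ : (Fin n → ℂ) → ℝ) : Set ℝ :=
  {η : ℝ | 0 < η ∧ η < 1 ∧ StrictPSHOn (fun z => -((-ρ z) ^ η)) Ω}

/-- The Diederich–Fornæss exponent of `ρ` (`0` if no exponent exists). -/
def dfExp {n : ℕ} (Ω : Set (Fin n → ℂ)) (ρ : (Fin n → ℂ) → ℝ) : ℝ :=
  sSup (insert 0 (dfExpSet Ω ρ))

/-- The Diederich–Fornæss index `DF(Ω)`. -/
def dfIndex {n : ℕ} (Ω : Set (Fin n → ℂ)) : ℝ :=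
  sSup {t : ℝ | ∃ V ρ, IsDefFn Ω V ρ ∧ t = dfExp Ω ρ}

/-- `L` is a smooth (1,0) tangent vector field for `ρ` on `A`. -/
def IsTangentField {n : ℕ} (ρ : (Fin n → ℂ) → ℝ) (L : (Fin n → ℂ) → (Fin n → ℂ))
    (A : Set (Fin n → ℂ)) : Prop :=
  ContDiffOn ℝ (⊤ : ℕ∞) L A ∧ ∀ z ∈ A, dirDeriv (L z) (cplx ρ) z = 0

/-- The key differential inequality
`(1/(η₂−1))|L_ρ(L,N)|²/‖∇ρ‖² − (1/2)(N L_ρ(L,L))/‖∇ρ‖ ≤ 0` at `p`. -/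
def keyIneqAt {n : ℕ} (ρ : (Fin n → ℂ) → ℝ) (L : (Fin n → ℂ) → (Fin n → ℂ)) (η₂ : ℝ)
    (p : Fin n → ℂ) : Prop :=
  1 / (η₂ - 1) * Complex.normSq (levi ρ (L p) (nfield ρ p) p) / (gradNorm ρ p) ^ 2 -
    1 / 2 * (fieldDeriv (nfield ρ) (fun w => levi ρ (L w) (L w) w) p).re / gradNorm ρ p ≤ 0

/-- The strict version of the key differential inequality. -/
def strictKeyIneqAt {n : ℕ} (ρ : (Fin n → ℂ) → ℝ) (L : (Fin n → ℂ) → (Fin n → ℂ)) (η₂ : ℝ)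
    (p : Fin n → ℂ) : Prop :=
  1 / (η₂ - 1) * Complex.normSq (levi ρ (L p) (nfield ρ p) p) / (gradNorm ρ p) ^ 2 -
    1 / 2 * (fieldDeriv (nfield ρ) (fun w => levi ρ (L w) (L w) w) p).re / gradNorm ρ p < 0

/-- `cl Ω` has a strong Stein neighborhood basis. -/
def HasStrongSteinBasis {n : ℕ} (Ω : Set (Fin n → ℂ)) : Prop :=
  ∃ (V : Set (Fin n → ℂ)) (ρ : (Fin n → ℂ) → ℝ), IsDefFn Ω V ρ ∧ ∃ ε₀ : ℝ, 0 < ε₀ ∧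
    (∀ z ∈ V, 0 ≤ ρ z → ρ z < ε₀ → fderiv ℝ ρ z ≠ 0) ∧
    ∀ ε : ℝ, 0 ≤ ε → ε < ε₀ → ∀ z ∈ V, ρ z = ε → LeviPseudoconvexAt ρ z

/-- Vanishing order at `0` of a holomorphic function `ℂ → ℂ` (`∞` if all derivatives vanish). -/
def orderC (h : ℂ → ℂ) : ℕ∞ :=
  sInf ((fun k : ℕ => (k : ℕ∞)) '' {k : ℕ | iteratedDeriv k h 0 ≠ 0})

/-- Vanishing order at `0` of a real-valued function on `ℂ`. -/
def orderR (g : ℂ → ℝ) : ℕ∞ :=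
  sInf ((fun k : ℕ => (k : ℕ∞)) '' {k : ℕ | iteratedFDeriv ℝ k g 0 ≠ 0})

/-- `ν(γ)`: minimal vanishing order at `0` of the components of `γ − p`. -/
def curveOrder {n : ℕ} (γ : ℂ → Fin n → ℂ) (p : Fin n → ℂ) : ℕ∞ :=
  ⨅ j, orderC (fun t => γ t j - p j)

/-- `p` is a boundary point of finite D'Angelo 1-type (w.r.t. the defining function `ρ`). -/
def FiniteTypePt {n : ℕ} (ρ : (Fin n → ℂ) → ℝ) (p : Fin n → ℂ) : Prop :=
  ∃ M : ℕ, ∀ γ : ℂ → Fin n → ℂ, (∀ j, AnalyticAt ℂ (fun t => γ t j) 0) → γ 0 = p →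
    ¬ (∀ᶠ t in nhds (0 : ℂ), γ t = p) →
    orderR (fun t => ρ (γ t)) ≤ (M : ℕ∞) * curveOrder γ p

/-- The set of exponents `η₂ > 1` for which the key differential inequality holds on `Σ_L`
for every (1,0) tangent vector field `L`. -/
def etaRhoSet {n : ℕ} (Ω U : Set (Fin n → ℂ)) (ρ : (Fin n → ℂ) → ℝ) : Set ℝ :=
  {η₂ : ℝ | 1 < η₂ ∧ ∀ L : (Fin n → ℂ) → (Fin n → ℂ), IsTangentField ρ L U →
    ∀ p ∈ frontier Ω, levi ρ (L p) (L p) p = 0 → keyIneqAt ρ L η₂ p}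

/-- `η_ρ` of the statement (`∞` if no admissible exponent exists). -/
def etaRho {n : ℕ} (Ω U : Set (Fin n → ℂ)) (ρ : (Fin n → ℂ) → ℝ) : ℝ≥0∞ :=
  sInf (ENNReal.ofReal '' etaRhoSet Ω U ρ)

open Filter Set

theorem Complex.smul_single_decomp {n : ℕ} (j : Fin n) (x : ℂ) :
    (Pi.single j x : Fin n → ℂ) =
      x.re • (Pi.single j 1 : Fin n → ℂ) + x.im • (Pi.single j I : Fin n → ℂ) := by
  rw [← Pi.single_smul, ← Pi.single_smul, ← Pi.single_add]
  congr 1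
  apply Complex.ext <;> simp

theorem map_pi_complex {n : ℕ} {G : Type*} [AddCommGroup G] [Module ℝ G]
    (T : (Fin n → ℂ) →ₗ[ℝ] G) (X : Fin n → ℂ) :
    T X = ∑ j, ((X j).re • T (Pi.single j 1) + (X j).im • T (Pi.single j I)) := by
  conv_lhs => rw [← Finset.univ_sum_single X]
  rw [map_sum]
  refine Finset.sum_congr rfl fun j _ => ?_
  rw [Complex.smul_single_decomp, map_add, map_smul, map_smul]

theorem sum_mul_wirtinger {n : ℕ} (T : (Fin n → ℂ) →ₗ[ℝ] ℂ) (X : Fin n → ℂ) :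
    ∑ j, X j * ((T (Pi.single j 1) - I * T (Pi.single j I)) / 2) =
      (T X - I * T (I • X)) / 2 := by
  rw [map_pi_complex T X, map_pi_complex T (I • X), Finset.mul_sum, ← Finset.sum_sub_distrib,
    Finset.sum_div]
  refine Finset.sum_congr rfl fun j _ => ?_
  conv_lhs => rw [← Complex.re_add_im (X j)]
  simp only [Pi.smul_apply, smul_eq_mul, Complex.real_smul, Complex.mul_re, Complex.mul_im,
    Complex.I_re, Complex.I_im]
  push_cast
  linear_combination (-(X j).im * T (Pi.single j I) / 2) * Complex.I_sq

theorem sum_conj_mul_wirtinger {n : ℕ} (T : (Fin n → ℂ) →ₗ[ℝ] ℂ) (X : Fin n → ℂ) :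
    ∑ j, (starRingEnd ℂ) (X j) * ((T (Pi.single j 1) + I * T (Pi.single j I)) / 2) =
      (T X + I * T (I • X)) / 2 := by
  rw [map_pi_complex T X, map_pi_complex T (I • X), Finset.mul_sum, ← Finset.sum_add_distrib,
    Finset.sum_div]
  refine Finset.sum_congr rfl fun j _ => ?_
  conv_lhs => rw [← Complex.re_add_im (X j)]
  simp only [Pi.smul_apply, smul_eq_mul, Complex.real_smul, Complex.mul_re, Complex.mul_im,
    Complex.I_re, Complex.I_im, map_add, map_mul, Complex.conj_ofReal, Complex.conj_I]
  push_cast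
  linear_combination (-(X j).im * T (Pi.single j I) / 2) * Complex.I_sq

theorem dirDeriv_eq_fderiv {n : ℕ} (X : Fin n → ℂ) (f : (Fin n → ℂ) → ℂ) (z : Fin n → ℂ) :
    dirDeriv X f z = (fderiv ℝ f z X - I * fderiv ℝ f z (I • X)) / 2 :=
  sum_mul_wirtinger (fderiv ℝ f z).toLinearMap X

theorem fderiv_cplx {n : ℕ} {ρ : (Fin n → ℂ) → ℝ} {z : Fin n → ℂ} (h : DifferentiableAt ℝ ρ z)
    (v : Fin n → ℂ) : fderiv ℝ (cplx ρ) z v = (fderiv ℝ ρ z v : ℂ) := by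
  have := (Complex.ofRealCLM.hasFDerivAt (x := ρ z)).comp z h.hasFDerivAt
  have h2 : fderiv ℝ (cplx ρ) z = _ := this.fderiv
  rw [h2]; rfl

theorem dirDeriv_cplx {n : ℕ} {ρ : (Fin n → ℂ) → ℝ} {z : Fin n → ℂ}
    (h : DifferentiableAt ℝ ρ z) (X : Fin n → ℂ) :
    dirDeriv X (cplx ρ) z = ((fderiv ℝ ρ z X : ℂ) - I * (fderiv ℝ ρ z (I • X) : ℂ)) / 2 := by
  rw [dirDeriv_eq_fderiv, fderiv_cplx h, fderiv_cplx h]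

theorem dirDeriv_cplx_re {n : ℕ} {ρ : (Fin n → ℂ) → ℝ} {z : Fin n → ℂ}
    (h : DifferentiableAt ℝ ρ z) (X : Fin n → ℂ) :
    (dirDeriv X (cplx ρ) z).re = fderiv ℝ ρ z X / 2 := by
  rw [dirDeriv_cplx h, Complex.div_ofNat_re]; simp

theorem dirDeriv_cplx_im {n : ℕ} {ρ : (Fin n → ℂ) → ℝ} {z : Fin n → ℂ}
    (h : DifferentiableAt ℝ ρ z) (X : Fin n → ℂ) :
    (dirDeriv X (cplx ρ) z).im = -fderiv ℝ ρ z (I • X) / 2 := by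
  rw [dirDeriv_cplx h, Complex.div_ofNat_im]; simp

theorem dirDeriv_add {n : ℕ} (X Y : Fin n → ℂ) (f : (Fin n → ℂ) → ℂ) (z : Fin n → ℂ) :
    dirDeriv (X + Y) f z = dirDeriv X f z + dirDeriv Y f z := by
  simp [dirDeriv, add_mul, Finset.sum_add_distrib]

theorem dirDeriv_smul {n : ℕ} (c : ℂ) (X : Fin n → ℂ) (f : (Fin n → ℂ) → ℂ) (z : Fin n → ℂ) :
    dirDeriv (c • X) f z = c * dirDeriv X f z := by
  simp [dirDeriv, mul_assoc, Finset.mul_sum]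

/-- The second derivative of `ρ` at `z`. -/
def hess {n : ℕ} (ρ : (Fin n → ℂ) → ℝ) (z : Fin n → ℂ) :
    (Fin n → ℂ) →L[ℝ] (Fin n → ℂ) →L[ℝ] ℝ :=
  fderiv ℝ (fderiv ℝ ρ) z

theorem ContDiffAt.hasFDerivAt_fderiv {n : ℕ} {ρ : (Fin n → ℂ) → ℝ} {z : Fin n → ℂ}
    (h : ContDiffAt ℝ 2 ρ z) : HasFDerivAt (fderiv ℝ ρ) (hess ρ z) z :=
  ((h.fderiv_right (m := 1) (by norm_num)).differentiableAt (by norm_num)).hasFDerivAt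

theorem ContDiffAt.eventually_differentiableAt {n : ℕ} {ρ : (Fin n → ℂ) → ℝ} {z : Fin n → ℂ}
    (h : ContDiffAt ℝ 2 ρ z) : ∀ᶠ w in 𝓝 z, DifferentiableAt ℝ ρ w :=
  (h.eventually (by simp)).mono fun _ hw => hw.differentiableAt (by norm_num)

theorem fderiv_dzbar_cplx {n : ℕ} {ρ : (Fin n → ℂ) → ℝ} {z : Fin n → ℂ}
    (h : ContDiffAt ℝ 2 ρ z) (k : Fin n) (X : Fin n → ℂ) :
    fderiv ℝ (fun w => dzbar k (cplx ρ) w) z X =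
      ((hess ρ z X (Pi.single k 1) : ℂ) + I * (hess ρ z X (Pi.single k I) : ℂ)) / 2 := by
  have key : ∀ e : Fin n → ℂ, HasFDerivAt (fun w => ((fderiv ℝ ρ w e : ℝ) : ℂ))
      (Complex.ofRealCLM.comp ((ContinuousLinearMap.apply ℝ ℝ e).comp (hess ρ z))) z := fun e =>
    Complex.ofRealCLM.hasFDerivAt.comp z
      ((ContinuousLinearMap.apply ℝ ℝ e).hasFDerivAt.comp z h.hasFDerivAt_fderiv)
  have h1 : (fun w => dzbar k (cplx ρ) w) =ᶠ[𝓝 z] fun w =>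
      (((fderiv ℝ ρ w (Pi.single k 1) : ℝ) : ℂ) +
        I * ((fderiv ℝ ρ w (Pi.single k I) : ℝ) : ℂ)) * (2 : ℂ)⁻¹ := by
    filter_upwards [h.eventually_differentiableAt] with w hw
    rw [dzbar, fderiv_cplx hw, fderiv_cplx hw, div_eq_mul_inv]
  rw [h1.fderiv_eq, (((key _).fun_add ((key _).const_mul I)).mul_const (2 : ℂ)⁻¹).fderiv]
  simp
  ring

theorem levi_eq_hess {n : ℕ} {ρ : (Fin n → ℂ) → ℝ} {z : Fin n → ℂ}
    (h : ContDiffAt ℝ 2 ρ z) (X Y : Fin n → ℂ) :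
    levi ρ X Y z = (((hess ρ z X Y + hess ρ z (I • X) (I • Y) : ℝ) : ℂ) +
      I * ((hess ρ z X (I • Y) - hess ρ z (I • X) Y : ℝ) : ℂ)) / 4 := by
  have h1 : levi ρ X Y z = ∑ k, (starRingEnd ℂ) (Y k) *
      dirDeriv X (fun w => dzbar k (cplx ρ) w) z := by
    rw [levi, Finset.sum_comm]
    refine Finset.sum_congr rfl fun k _ => ?_
    rw [dirDeriv, Finset.mul_sum]
    exact Finset.sum_congr rfl fun j _ => by ring
  have h2 := sum_conj_mul_wirtinger
    (Complex.ofRealCLM.toLinearMap ∘ₗ (hess ρ z X).toLinearMap) Y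
  have h3 := sum_conj_mul_wirtinger
    (Complex.ofRealCLM.toLinearMap ∘ₗ (hess ρ z (I • X)).toLinearMap) Y
  simp only [LinearMap.comp_apply, ContinuousLinearMap.coe_coe, Complex.ofRealCLM_apply] at h2 h3
  have h4 : levi ρ X Y z = ((((hess ρ z X Y : ℝ) : ℂ) + I * (hess ρ z X (I • Y) : ℝ)) / 2 -
      I * ((((hess ρ z (I • X) Y : ℝ) : ℂ) + I * (hess ρ z (I • X) (I • Y) : ℝ)) / 2)) / 2 := by
    rw [h1, ← h2, ← h3, Finset.mul_sum, ← Finset.sum_sub_distrib, Finset.sum_div]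
    refine Finset.sum_congr rfl fun k _ => ?_
    rw [dirDeriv_eq_fderiv, fderiv_dzbar_cplx h, fderiv_dzbar_cplx h]
    ring
  rw [h4]
  push_cast
  linear_combination (-(hess ρ z (I • X) (I • Y) : ℂ) / 4) * Complex.I_sq

theorem hess_symm {n : ℕ} {ρ : (Fin n → ℂ) → ℝ} {z : Fin n → ℂ}
    (h : ContDiffAt ℝ 2 ρ z) (X Y : Fin n → ℂ) : hess ρ z X Y = hess ρ z Y X :=
  h.isSymmSndFDerivAt (by simp) X Y

theorem levi_self_re {n : ℕ} {ρ : (Fin n → ℂ) → ℝ} {z : Fin n → ℂ}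
    (h : ContDiffAt ℝ 2 ρ z) (X : Fin n → ℂ) :
    (levi ρ X X z).re = (hess ρ z X X + hess ρ z (I • X) (I • X)) / 4 := by
  rw [levi_eq_hess h, Complex.div_ofNat_re]; simp

theorem levi_conj_symm {n : ℕ} {ρ : (Fin n → ℂ) → ℝ} {z : Fin n → ℂ}
    (h : ContDiffAt ℝ 2 ρ z) (X Y : Fin n → ℂ) :
    levi ρ Y X z = (starRingEnd ℂ) (levi ρ X Y z) := by
  rw [levi_eq_hess h, levi_eq_hess h, hess_symm h Y X, hess_symm h (I • Y) (I • X),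
    hess_symm h Y (I • X), hess_symm h (I • Y) X]
  simp only [map_div₀, map_add, map_mul, Complex.conj_ofReal, Complex.conj_I, map_ofNat]
  push_cast
  ring

theorem levi_self_im {n : ℕ} {ρ : (Fin n → ℂ) → ℝ} {z : Fin n → ℂ}
    (h : ContDiffAt ℝ 2 ρ z) (X : Fin n → ℂ) : (levi ρ X X z).im = 0 :=
  Complex.conj_eq_iff_im.1 (levi_conj_symm h X X).symm

theorem levi_add_smul {n : ℕ} (ρ : (Fin n → ℂ) → ℝ) (z X Y Z : Fin n → ℂ) (c : ℂ) :
    levi ρ (X + c • Y) Z z = levi ρ X Z z + c * levi ρ Y Z z := by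
  simp only [levi, Finset.mul_sum, ← Finset.sum_add_distrib]
  exact Finset.sum_congr rfl fun j _ => Finset.sum_congr rfl fun k _ => by
    simp only [Pi.add_apply, Pi.smul_apply, smul_eq_mul]; ring

theorem levi_smul_smul {n : ℕ} (ρ : (Fin n → ℂ) → ℝ) (z X Y : Fin n → ℂ) (c d : ℂ) :
    levi ρ (c • X) (d • Y) z = c * (starRingEnd ℂ) d * levi ρ X Y z := by
  simp only [levi, Finset.mul_sum]
  exact Finset.sum_congr rfl fun j _ => Finset.sum_congr rfl fun k _ => by
    simp only [Pi.smul_apply, smul_eq_mul, map_mul]; ring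

theorem levi_self_add_smul_re {n : ℕ} {ρ : (Fin n → ℂ) → ℝ} {z : Fin n → ℂ}
    (h : ContDiffAt ℝ 2 ρ z) (X Y : Fin n → ℂ) (c : ℂ) :
    (levi ρ (X + c • Y) (X + c • Y) z).re = (levi ρ X X z).re +
      2 * ((starRingEnd ℂ) c * levi ρ X Y z).re + normSq c * (levi ρ Y Y z).re := by
  have e : levi ρ (X + c • Y) (X + c • Y) z = levi ρ X X z + (starRingEnd ℂ) c * levi ρ X Y z
      + (starRingEnd ℂ) ((starRingEnd ℂ) c * levi ρ X Y z) + (normSq c : ℂ) * levi ρ Y Y z := by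
    rw [levi_add_smul, levi_conj_symm h (X + c • Y) X, levi_conj_symm h (X + c • Y) Y,
      levi_add_smul, levi_add_smul, map_add, map_add, ← levi_conj_symm h, ← levi_conj_symm h,
      map_mul, map_mul, map_mul, ← levi_conj_symm h, ← levi_conj_symm h X Y,
      Complex.conj_conj, Complex.normSq_eq_conj_mul_self]
    linear_combination (-((starRingEnd ℂ) c * c)) * levi_conj_symm h Y Y
  rw [e]
  simp only [Complex.add_re, Complex.conj_re, Complex.re_ofReal_mul]
  ring

theorem normSq_dirDeriv_cplx {n : ℕ} {ρ : (Fin n → ℂ) → ℝ} {z : Fin n → ℂ}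
    (h : DifferentiableAt ℝ ρ z) (X : Fin n → ℂ) :
    normSq (dirDeriv X (cplx ρ) z) =
      (fderiv ℝ ρ z X ^ 2 + fderiv ℝ ρ z (I • X) ^ 2) / 4 := by
  rw [Complex.normSq_apply, dirDeriv_cplx_re h, dirDeriv_cplx_im h]; ring

theorem hess_mul {n : ℕ} {f g : (Fin n → ℂ) → ℝ} {z : Fin n → ℂ}
    (hf : ContDiffAt ℝ 2 f z) (hg : ContDiffAt ℝ 2 g z) (v : Fin n → ℂ) :
    hess (fun w => f w * g w) z v v =
      f z * hess g z v v + g z * hess f z v v + 2 * (fderiv ℝ f z v * fderiv ℝ g z v) := by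
  have h1 : fderiv ℝ (fun w => f w * g w) =ᶠ[𝓝 z]
      fun w => f w • fderiv ℝ g w + g w • fderiv ℝ f w := by
    filter_upwards [hf.eventually_differentiableAt, hg.eventually_differentiableAt] with w h1 h2
    exact fderiv_fun_mul h1 h2
  have hf1 := (hf.differentiableAt (by norm_num)).hasFDerivAt
  have hg1 := (hg.differentiableAt (by norm_num)).hasFDerivAt
  rw [hess, h1.fderiv_eq,
    ((hf1.fun_smul hg.hasFDerivAt_fderiv).fun_add (hg1.fun_smul hf.hasFDerivAt_fderiv)).fderiv]
  simp
  ring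

theorem hess_rpow {n : ℕ} {f : (Fin n → ℂ) → ℝ} {z : Fin n → ℂ}
    (hf : ContDiffAt ℝ 2 f z) (hpos : 0 < f z) (η : ℝ) (v : Fin n → ℂ) :
    hess (fun w => f w ^ η) z v v =
      η * f z ^ (η - 1) * hess f z v v + η * ((η - 1) * f z ^ (η - 2)) * fderiv ℝ f z v ^ 2 := by
  have hf1 := (hf.differentiableAt (by norm_num)).hasFDerivAt
  have h1 : fderiv ℝ (fun w => f w ^ η) =ᶠ[𝓝 z]
      fun w => (η * f w ^ (η - 1)) • fderiv ℝ f w := by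
    filter_upwards [hf.eventually_differentiableAt,
      hf.continuousAt.eventually (lt_mem_nhds hpos)] with w h1 h2
    exact (h1.hasFDerivAt.rpow_const (Or.inl h2.ne')).fderiv
  rw [hess, h1.fderiv_eq, (((hf1.rpow_const (p := η - 1) (Or.inl hpos.ne')).const_mul η).fun_smul
    hf.hasFDerivAt_fderiv).fderiv]
  simp [show η - 1 - 1 = η - 2 by ring]
  ring

theorem levi_mul_self_re {n : ℕ} {f g : (Fin n → ℂ) → ℝ} {z : Fin n → ℂ}
    (hf : ContDiffAt ℝ 2 f z) (hg : ContDiffAt ℝ 2 g z) (X : Fin n → ℂ) :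
    (levi (fun w => f w * g w) X X z).re =
      f z * (levi g X X z).re + g z * (levi f X X z).re +
        2 * (dirDeriv X (cplx f) z * (starRingEnd ℂ) (dirDeriv X (cplx g) z)).re := by
  have hf1 := hf.differentiableAt (by norm_num)
  have hg1 := hg.differentiableAt (by norm_num)
  rw [levi_self_re (hf.mul hg), levi_self_re hf, levi_self_re hg, hess_mul hf hg, hess_mul hf hg,
    Complex.mul_re, Complex.conj_re, Complex.conj_im, dirDeriv_cplx_re hf1, dirDeriv_cplx_re hg1,
    dirDeriv_cplx_im hf1, dirDeriv_cplx_im hg1]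
  ring

theorem dirDeriv_cplx_mul {n : ℕ} {f g : (Fin n → ℂ) → ℝ} {z : Fin n → ℂ}
    (hf : DifferentiableAt ℝ f z) (hg : DifferentiableAt ℝ g z) (X : Fin n → ℂ) :
    dirDeriv X (cplx fun w => f w * g w) z =
      f z * dirDeriv X (cplx g) z + g z * dirDeriv X (cplx f) z := by
  rw [dirDeriv_cplx (hf.fun_mul hg), dirDeriv_cplx hf, dirDeriv_cplx hg, fderiv_fun_mul hf hg]
  simp
  ring

theorem levi_rpow_self_re {n : ℕ} {f : (Fin n → ℂ) → ℝ} {z : Fin n → ℂ}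
    (hf : ContDiffAt ℝ 2 f z) (hpos : 0 < f z) (η : ℝ) (X : Fin n → ℂ) :
    (levi (fun w => f w ^ η) X X z).re = η * f z ^ (η - 2) *
      (f z * (levi f X X z).re + (η - 1) * normSq (dirDeriv X (cplx f) z)) := by
  have e : f z ^ (η - 1) = f z ^ (η - 2) * f z := by
    rw [← Real.rpow_add_one hpos.ne']; ring_nf
  rw [levi_self_re (hf.rpow_const_of_ne hpos.ne'), hess_rpow hf hpos, hess_rpow hf hpos,
    levi_self_re hf, normSq_dirDeriv_cplx (hf.differentiableAt (by norm_num)), e]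
  ring

theorem levi_rpow_self_re_pos_iff {n : ℕ} {f : (Fin n → ℂ) → ℝ} {z : Fin n → ℂ}
    (hf : ContDiffAt ℝ 2 f z) (hpos : 0 < f z) {η : ℝ} (hη : 0 < η) (X : Fin n → ℂ) :
    0 < (levi (fun w => f w ^ η) X X z).re ↔
      0 < f z * (levi f X X z).re + (η - 1) * normSq (dirDeriv X (cplx f) z) := by
  rw [levi_rpow_self_re hf hpos]
  exact mul_pos_iff_of_pos_left (mul_pos hη (Real.rpow_pos_of_pos hpos _))

namespace IsDefFn

variable {n : ℕ} {Ω V : Set (Fin n → ℂ)} {ρ : (Fin n → ℂ) → ℝ} {z : Fin n → ℂ}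

theorem contDiffAt (h : IsDefFn Ω V ρ) (hz : z ∈ V) : ContDiffAt ℝ (⊤ : ℕ∞) ρ z :=
  h.smooth.contDiffAt (h.isOpen.mem_nhds hz)

theorem contDiffAt_two (h : IsDefFn Ω V ρ) (hz : z ∈ V) : ContDiffAt ℝ 2 ρ z :=
  (h.contDiffAt hz).of_le (WithTop.coe_le_coe.2 le_top)

theorem differentiableAt (h : IsDefFn Ω V ρ) (hz : z ∈ V) : DifferentiableAt ℝ ρ z :=
  (h.contDiffAt_two hz).differentiableAt (by norm_num)

theorem frontier_subset (h : IsDefFn Ω V ρ) : frontier Ω ⊆ V :=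
  frontier_subset_closure.trans h.subset

theorem nonneg_of_notMem (h : IsDefFn Ω V ρ) (hz : z ∈ V) (hzΩ : z ∉ Ω) : 0 ≤ ρ z := by
  by_contra hlt
  exact hzΩ (by rw [h.eq]; exact ⟨hz, not_le.1 hlt⟩)

theorem neg_of_mem (h : IsDefFn Ω V ρ) (hz : z ∈ Ω) : ρ z < 0 := by
  rw [h.eq] at hz; exact hz.2

theorem notMem_closure (h : IsDefFn Ω V ρ) (hz : z ∈ V) (hpos : 0 < ρ z) : z ∉ closure Ω := by
  intro hcl
  rw [mem_closure_iff_frequently] at hcl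
  refine hcl ?_
  filter_upwards [(h.differentiableAt hz).continuousAt.eventually (lt_mem_nhds hpos)] with w hw hwΩ
  exact lt_asymm hw (h.neg_of_mem hwΩ)

theorem eq_zero (h : IsDefFn Ω V ρ) (hΩ : IsOpen Ω) (hz : z ∈ frontier Ω) : ρ z = 0 := by
  refine le_antisymm ?_ (h.nonneg_of_notMem (h.frontier_subset hz) ?_)
  · by_contra hlt
    exact h.notMem_closure (h.frontier_subset hz) (not_le.1 hlt) (frontier_subset_closure hz)
  · rw [hΩ.frontier_eq] at hz
    exact hz.2

theorem mem_closure_of_eq_zero (h : IsDefFn Ω V ρ) (hz : z ∈ V) (h0 : ρ z = 0)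
    (hd : fderiv ℝ ρ z ≠ 0) : z ∈ closure Ω := by
  by_contra hcl
  refine hd (IsLocalMin.fderiv_eq_zero (f := ρ) (a := z) ?_)
  filter_upwards [h.isOpen.mem_nhds hz, isClosed_closure.isOpen_compl.mem_nhds hcl] with w hw hw'
  rw [h0]
  exact h.nonneg_of_notMem hw fun hwΩ => hw' (subset_closure hwΩ)

theorem mem_frontier (h : IsDefFn Ω V ρ) (hΩ : IsOpen Ω) (hz : z ∈ V) (h0 : ρ z = 0)
    (hd : fderiv ℝ ρ z ≠ 0) : z ∈ frontier Ω := by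
  rw [hΩ.frontier_eq]
  exact ⟨h.mem_closure_of_eq_zero hz h0 hd, fun hzΩ => (h.neg_of_mem hzΩ).ne h0⟩

theorem pos_of_notMem_closure (h : IsDefFn Ω V ρ) (hz : z ∈ V) (hcl : z ∉ closure Ω)
    (hd : fderiv ℝ ρ z ≠ 0) : 0 < ρ z :=
  lt_of_le_of_ne (h.nonneg_of_notMem hz fun hzΩ => hcl (subset_closure hzΩ))
    fun h0 => hcl (h.mem_closure_of_eq_zero hz h0.symm hd)

end IsDefFn

theorem HasDerivAt.eventually_pos_of_eq_zero {h : ℝ → ℝ} {a : ℝ} (hd : HasDerivAt h a 0)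
    (h0 : h 0 = 0) (ha : 0 < a) : ∀ᶠ t in 𝓝[>] (0 : ℝ), 0 < h t := by
  have h1 := (hasDerivAt_iff_tendsto_slope.1 hd).mono_left
    (nhdsWithin_mono 0 fun (t : ℝ) (ht : 0 < t) => ht.ne')
  filter_upwards [h1.eventually (lt_mem_nhds ha), self_mem_nhdsWithin] with t ht ht0
  rw [slope_def_field, h0, sub_zero, sub_zero] at ht
  exact (div_pos_iff_of_pos_right ht0).1 ht

theorem eventually_pos_of_hasDerivAt_deriv {h h' : ℝ → ℝ} {a : ℝ}
    (hd : ∀ᶠ t in 𝓝 (0 : ℝ), HasDerivAt h (h' t) t) (hd' : HasDerivAt h' a 0)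
    (h0 : h 0 = 0) (h0' : h' 0 = 0) (ha : 0 < a) : ∀ᶠ t in 𝓝[>] (0 : ℝ), 0 < h t := by
  obtain ⟨δ, hδ, h1⟩ := Metric.eventually_nhds_iff_ball.1 hd
  obtain ⟨ε, hε, h2⟩ := (mem_nhdsGT_iff_exists_Ioo_subset).1 (hd'.eventually_pos_of_eq_zero h0' ha)
  have hlt : 0 < min δ ε := lt_min hδ hε
  filter_upwards [Ioo_mem_nhdsGT hlt] with t ht
  have ball_of : ∀ s ∈ Icc 0 t, s ∈ Metric.ball (0 : ℝ) δ := fun s hs => by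
    rw [mem_ball_zero_iff, Real.norm_of_nonneg hs.1]
    exact lt_of_le_of_lt hs.2 (ht.2.trans_le (min_le_left _ _))
  have hmono : StrictMonoOn h (Icc 0 t) := by
    refine strictMonoOn_of_deriv_pos (convex_Icc 0 t)
      (fun s hs => (h1 s (ball_of s hs)).continuousAt.continuousWithinAt) fun s hs => ?_
    rw [interior_Icc] at hs
    rw [(h1 s (ball_of s ⟨hs.1.le, hs.2.le⟩)).deriv]
    exact h2 ⟨hs.1, hs.2.trans (ht.2.trans_le (min_le_right _ _))⟩
  rw [← h0]
  exact hmono ⟨le_rfl, ht.1.le⟩ ⟨ht.1.le, le_rfl⟩ ht.1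

theorem eventually_pos_along_line {E : Type*} [NormedAddCommGroup E] [NormedSpace ℝ E] {f : E → ℝ}
    {p v : E} (hf : DifferentiableAt ℝ f p) (h0 : f p = 0) (hv : 0 < fderiv ℝ f p v) :
    ∀ᶠ t in 𝓝[>] (0 : ℝ), 0 < f (p + t • v) := by
  have h1 : HasDerivAt (fun t : ℝ => p + t • v) v 0 := by
    simpa using ((hasDerivAt_id (0 : ℝ)).smul_const v).const_add p
  have h2 : HasFDerivAt f (fderiv ℝ f p) (p + (0 : ℝ) • v) := by simpa using hf.hasFDerivAt
  exact (h2.comp_hasDerivAt (0 : ℝ) h1).eventually_pos_of_eq_zero (by simpa using h0) hv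

theorem eventually_pos_along_parabola {E : Type*} [NormedAddCommGroup E] [NormedSpace ℝ E]
    {f : E → ℝ} {H : E →L[ℝ] E →L[ℝ] ℝ} {p v w : E}
    (hf : ∀ᶠ q in 𝓝 p, DifferentiableAt ℝ f q) (hH : HasFDerivAt (fderiv ℝ f) H p)
    (h0 : f p = 0) (hv : fderiv ℝ f p v = 0) (hw : 0 < H v v + 2 * fderiv ℝ f p w) :
    ∀ᶠ t in 𝓝[>] (0 : ℝ), 0 < f (p + t • v + t ^ 2 • w) := by
  have hγ : ∀ t : ℝ, HasDerivAt (fun t : ℝ => p + t • v + t ^ 2 • w) (v + (2 * t) • w) t := by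
    intro t
    have := (((hasDerivAt_id t).smul_const v).const_add p).fun_add
      ((hasDerivAt_pow 2 t).smul_const w)
    simpa using this
  have hγ0 : p + (0 : ℝ) • v + (0 : ℝ) ^ 2 • w = p := by simp
  have hcont : Tendsto (fun t : ℝ => p + t • v + t ^ 2 • w) (𝓝 0) (𝓝 p) := by
    simpa using (hγ 0).continuousAt.tendsto
  have hvel : HasDerivAt (fun t : ℝ => v + (2 * t) • w) ((2 : ℝ) • w) 0 := by
    simpa using (((hasDerivAt_id (0 : ℝ)).const_mul 2).smul_const w).const_add v
  have hpath : HasDerivAt (fderiv ℝ f ∘ fun t : ℝ => p + t • v + t ^ 2 • w) (H v) 0 := by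
    rw [← hγ0] at hH
    simpa using hH.comp_hasDerivAt (0 : ℝ) (hγ 0)
  have hacc : HasDerivAt (fun t : ℝ => fderiv ℝ f (p + t • v + t ^ 2 • w) (v + (2 * t) • w))
      (H v v + 2 * fderiv ℝ f p w) 0 := by
    simpa using hpath.clm_apply hvel
  refine eventually_pos_of_hasDerivAt_deriv ?_ hacc (by simpa using h0) (by simpa using hv) hw
  filter_upwards [hcont.eventually hf] with t ht
  exact ht.hasFDerivAt.comp_hasDerivAt t (hγ t)

theorem tendsto_line {E : Type*} [NormedAddCommGroup E] [NormedSpace ℝ E] (p v : E) :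
    Tendsto (fun t : ℝ => p + t • v) (𝓝[>] 0) (𝓝 p) := by
  have : Continuous fun t : ℝ => p + t • v := by fun_prop
  simpa using (this.tendsto 0).mono_left nhdsWithin_le_nhds

section Comparison

variable {n : ℕ} {f g : (Fin n → ℂ) → ℝ} {p : Fin n → ℂ}

theorem fderiv_nonneg_of_pos_imp_nonneg (hf : DifferentiableAt ℝ f p) (hg : DifferentiableAt ℝ g p)
    (hf0 : f p = 0) (hg0 : g p = 0) (hfg : ∀ᶠ w in 𝓝 p, 0 < f w → 0 ≤ g w) {v : Fin n → ℂ}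
    (hv : 0 < fderiv ℝ f p v) : 0 ≤ fderiv ℝ g p v := by
  by_contra hlt
  have h1 := eventually_pos_along_line (f := fun w => -g w) hg.fun_neg (by simpa using hg0)
    (v := v) (by rw [fderiv_fun_neg]; simpa using hlt)
  obtain ⟨t, ht1, ht2, ht3⟩ := ((eventually_pos_along_line hf hf0 hv).and
    (h1.and ((tendsto_line p v).eventually hfg))).exists
  linarith [ht3 ht1]

theorem fderiv_eq_zero_of_pos_imp_nonneg (hf : DifferentiableAt ℝ f p)
    (hg : DifferentiableAt ℝ g p) (hf0 : f p = 0) (hg0 : g p = 0)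
    (hfg : ∀ᶠ w in 𝓝 p, 0 < f w → 0 ≤ g w) (hdg : fderiv ℝ g p ≠ 0) {v : Fin n → ℂ}
    (hv : fderiv ℝ g p v = 0) : fderiv ℝ f p v = 0 := by
  have key : ∀ v, fderiv ℝ g p v = 0 → fderiv ℝ f p v ≤ 0 := by
    intro v hv
    by_contra! hpos
    obtain ⟨u, hu⟩ : ∃ u, fderiv ℝ g p u < 0 := by
      obtain ⟨u, hu⟩ : ∃ u, fderiv ℝ g p u ≠ 0 := by
        by_contra! h0
        exact hdg (ContinuousLinearMap.ext h0)
      rcases lt_or_gt_of_ne hu with h1 | h1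
      · exact ⟨u, h1⟩
      · exact ⟨-u, by simpa using h1⟩
    set ε := fderiv ℝ f p v / (2 * (|fderiv ℝ f p u| + 1)) with hε
    have hεpos : 0 < ε := by positivity
    have h2 : ε * |fderiv ℝ f p u| < fderiv ℝ f p v := by
      rw [hε, div_mul_eq_mul_div, div_lt_iff₀ (by positivity)]
      nlinarith [abs_nonneg (fderiv ℝ f p u)]
    have h3 := fderiv_nonneg_of_pos_imp_nonneg hf hg hf0 hg0 hfg (v := v + ε • u) (by
      rw [map_add, map_smul, smul_eq_mul]
      nlinarith [neg_abs_le (fderiv ℝ f p u)])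
    rw [map_add, map_smul, smul_eq_mul, hv] at h3
    nlinarith
  refine le_antisymm (key v hv) ?_
  have := key (-v) (by rw [map_neg, hv, neg_zero])
  rw [map_neg] at this
  linarith

theorem hess_ge_of_pos_imp_nonneg (hf : ContDiffAt ℝ 2 f p) (hg : ContDiffAt ℝ 2 g p)
    (hf0 : f p = 0) (hg0 : g p = 0) (hfg : ∀ᶠ w in 𝓝 p, 0 < f w → 0 ≤ g w) {u v : Fin n → ℂ}
    (hu : fderiv ℝ f p u = 1) (hvf : fderiv ℝ f p v = 0) (hvg : fderiv ℝ g p v = 0) :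
    fderiv ℝ g p u * hess f p v v ≤ hess g p v v := by
  set l := fderiv ℝ g p u with hl
  have hg1 := hg.differentiableAt (by norm_num)
  have hl0 : 0 ≤ l := fderiv_nonneg_of_pos_imp_nonneg (hf.differentiableAt (by norm_num)) hg1
    hf0 hg0 hfg (by rw [hu]; exact one_pos)
  have key : ∀ s : ℝ, 0 < hess f p v v + 2 * s → 0 ≤ hess g p v v + 2 * (s * l) := by
    intro s hs
    by_contra! hlt
    have hng : HasFDerivAt (fderiv ℝ fun w => -g w) (-hess g p) p := by
      rw [show fderiv ℝ (fun w => -g w) = fun w => -fderiv ℝ g w from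
        funext fun w => fderiv_fun_neg]
      exact hg.hasFDerivAt_fderiv.fun_neg
    have h1 := eventually_pos_along_parabola (f := fun w => -g w) (v := v) (w := s • u)
      (hg.eventually_differentiableAt.mono fun w hw => hw.fun_neg) hng (by simpa using hg0)
      (by rw [fderiv_fun_neg]; simpa using hvg) (by
        rw [fderiv_fun_neg]
        simp only [neg_apply, map_smul, smul_eq_mul, ← hl]
        linarith)
    have h2 := eventually_pos_along_parabola (v := v) (w := s • u)
      hf.eventually_differentiableAt hf.hasFDerivAt_fderiv hf0 hvf (by
        rw [map_smul, hu, smul_eq_mul, mul_one]; exact hs)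
    have hc : Tendsto (fun t : ℝ => p + t • v + t ^ 2 • (s • u)) (𝓝[>] 0) (𝓝 p) := by
      have : Continuous fun t : ℝ => p + t • v + t ^ 2 • (s • u) := by fun_prop
      simpa using (this.tendsto 0).mono_left nhdsWithin_le_nhds
    obtain ⟨t, ht1, ht2, ht3⟩ := (h1.and (h2.and (hc.eventually hfg))).exists
    linarith [ht3 ht2]
  refine le_of_forall_pos_le_add fun ε hε => ?_
  have h1 := key (-hess f p v v / 2 + ε / (2 * (l + 1))) (by
    have : 0 < ε / (2 * (l + 1)) := by positivity
    linarith)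
  have h2 : 2 * (ε / (2 * (l + 1)) * l) ≤ ε := by
    rw [div_mul_eq_mul_div, mul_div_assoc', div_le_iff₀ (by positivity)]
    nlinarith
  linarith

end Comparison

theorem LeviPseudoconvexAt.of_isDefFn {n : ℕ} {Ω V V' : Set (Fin n → ℂ)}
    {ρ σ : (Fin n → ℂ) → ℝ} (hρ : IsDefFn Ω V ρ) (hσ : IsDefFn Ω V' σ) (hΩ : IsOpen Ω)
    {p : Fin n → ℂ} (hp : p ∈ frontier Ω) (h : LeviPseudoconvexAt σ p) :
    LeviPseudoconvexAt ρ p := by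
  have hσ2 := hσ.contDiffAt_two (hσ.frontier_subset hp)
  have hρ2 := hρ.contDiffAt_two (hρ.frontier_subset hp)
  have hσ1 := hσ2.differentiableAt (by norm_num)
  have hρ1 := hρ2.differentiableAt (by norm_num)
  have hσ0 := hσ.eq_zero hΩ hp
  have hρ0 := hρ.eq_zero hΩ hp
  have himp : ∀ᶠ w in 𝓝 p, 0 < σ w → 0 ≤ ρ w := by
    filter_upwards [hρ.isOpen.mem_nhds (hρ.frontier_subset hp)] with w hw hpos
    exact hρ.nonneg_of_notMem hw fun hwΩ => lt_asymm hpos (hσ.neg_of_mem hwΩ)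
  obtain ⟨u, hu⟩ : ∃ u, fderiv ℝ σ p u = 1 := by
    obtain ⟨u, hu⟩ : ∃ u, fderiv ℝ σ p u ≠ 0 := by
      by_contra! h0
      exact hσ.grad_ne p hp (ContinuousLinearMap.ext h0)
    exact ⟨(fderiv ℝ σ p u)⁻¹ • u, by rw [map_smul, smul_eq_mul, inv_mul_cancel₀ hu]⟩
  intro X hX
  have hX1 : fderiv ℝ ρ p X = 0 := by
    have := congrArg Complex.re hX
    rw [dirDeriv_cplx_re hρ1, Complex.zero_re] at this
    linarith
  have hX2 : fderiv ℝ ρ p (I • X) = 0 := by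
    have := congrArg Complex.im hX
    rw [dirDeriv_cplx_im hρ1, Complex.zero_im] at this
    linarith
  have hd := hρ.grad_ne p hp
  have hY1 := fderiv_eq_zero_of_pos_imp_nonneg hσ1 hρ1 hσ0 hρ0 himp hd hX1
  have hY2 := fderiv_eq_zero_of_pos_imp_nonneg hσ1 hρ1 hσ0 hρ0 himp hd hX2
  have h1 := hess_ge_of_pos_imp_nonneg hσ2 hρ2 hσ0 hρ0 himp hu hY1 hX1
  have h2 := hess_ge_of_pos_imp_nonneg hσ2 hρ2 hσ0 hρ0 himp hu hY2 hX2
  have hl : 0 ≤ fderiv ℝ ρ p u := fderiv_nonneg_of_pos_imp_nonneg hσ1 hρ1 hσ0 hρ0 himp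
    (by rw [hu]; exact one_pos)
  have h3 := h X (by rw [dirDeriv_cplx hσ1, hY1, hY2]; simp)
  rw [levi_self_re hσ2] at h3
  rw [levi_self_re hρ2]
  nlinarith [mul_nonneg hl h3]

theorem eventually_mul_le_of_nonneg_on_zeros {E : Type*} [NormedAddCommGroup E] [NormedSpace ℝ E]
    {F : E × E → ℝ} {ρ : E → ℝ} {p X v : E} {κ : ℝ} (hF : ContDiffAt ℝ 1 F (p, X))
    (hρ : ContDiffAt ℝ 1 ρ p) (h0 : ρ p = 0) (hv : 0 < fderiv ℝ ρ p v)
    (hκ : κ * fderiv ℝ ρ p v < fderiv ℝ F (p, X) (v, 0))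
    (hnn : ∀ᶠ q in 𝓝 (p, X), ρ q.1 = 0 → 0 ≤ F q) :
    ∀ᶠ q in 𝓝 (p, X), 0 ≤ ρ q.1 → κ * ρ q.1 ≤ F q := by
  have hρ' : ContDiffAt ℝ 1 (fun q : E × E => ρ q.1) (p, X) :=
    ContDiffAt.comp (p, X) hρ contDiffAt_fst
  have hG : ContDiffAt ℝ 1 (fun q : E × E => F q - κ * ρ q.1) (p, X) :=
    hF.sub (contDiffAt_const.mul hρ')
  have hGv : 0 < fderiv ℝ (fun q : E × E => F q - κ * ρ q.1) (p, X) (v, 0) := by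
    have e1 := (hρ.differentiableAt (by norm_num)).hasFDerivAt.comp (p, X)
      (hasFDerivAt_fst (𝕜 := ℝ) (p := (p, X)))
    have e2 : HasFDerivAt (fun q : E × E => F q - κ * ρ q.1) _ (p, X) :=
      (hF.differentiableAt (by norm_num)).hasFDerivAt.fun_sub (e1.const_mul κ)
    rw [e2.fderiv]
    simpa using hκ
  have hGc : ContinuousAt
      (fun q => fderiv ℝ (fun q : E × E => F q - κ * ρ q.1) q (v, 0)) (p, X) :=
    ((hG.fderiv_right (m := 0) (by norm_num)).continuousAt).clm_apply continuousAt_const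
  have hall := ((hG.eventually (by simp)).and ((hGc.eventually (lt_mem_nhds hGv)).and
    ((hρ'.eventually (by simp)).and hnn)))
  obtain ⟨δ, hδ, hball⟩ := Metric.eventually_nhds_iff_ball.1 hall
  have hneg := eventually_pos_along_line (f := fun w => -ρ w) (v := -v)
    (hρ.differentiableAt (by norm_num)).fun_neg (by simpa using h0)
    (by rw [fderiv_fun_neg]; simpa using hv)
  obtain ⟨s, hs1, hs2, hs3⟩ : ∃ s : ℝ, 0 < -ρ (p + s • -v) ∧ 0 < s ∧ s * ‖v‖ < δ / 2 := by
    have hc : Tendsto (fun s : ℝ => s * ‖v‖) (𝓝[>] 0) (𝓝 0) := by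
      have : Continuous fun s : ℝ => s * ‖v‖ := by fun_prop
      simpa using (this.tendsto 0).mono_left nhdsWithin_le_nhds
    obtain ⟨s, h1, h2, h3⟩ := (hneg.and (eventually_mem_nhdsWithin.and
      (hc.eventually (gt_mem_nhds (half_pos hδ))))).exists
    exact ⟨s, h1, h2, h3⟩
  have hmem : ∀ q ∈ Metric.ball (p, X) (δ / 2), ∀ t ∈ Icc 0 s,
      (q.1 - t • v, q.2) ∈ Metric.ball (p, X) δ := by
    intro q hq t ht
    have e : dist (q.1 - t • v, q.2) q ≤ t * ‖v‖ := by
      rw [Prod.dist_eq, dist_self, dist_eq_norm, sub_sub_cancel_left, norm_neg, norm_smul,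
        Real.norm_of_nonneg ht.1]
      exact max_le le_rfl (mul_nonneg ht.1 (norm_nonneg v))
    have e2 : t * ‖v‖ ≤ s * ‖v‖ := mul_le_mul_of_nonneg_right ht.2 (norm_nonneg v)
    have := dist_triangle (q.1 - t • v, q.2) q (p, X)
    rw [Metric.mem_ball] at hq ⊢
    linarith
  have hps : ContinuousAt (fun q : E × E => ρ (q.1 - s • v)) (p, X) := by
    have h1 : ContinuousAt ρ (p - s • v) := by
      have hm := hball _ (hmem (p, X) (Metric.mem_ball_self (half_pos hδ)) s ⟨hs2.le, le_rfl⟩)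
      have h3 : ContDiffAt ℝ 1 (fun w : E => ρ w) (p - s • v) :=
        ContDiffAt.comp (p - s • v) (g := fun q : E × E => ρ q.1) (f := fun w => (w, X))
          hm.2.2.1 (contDiffAt_id.prodMk contDiffAt_const)
      exact h3.continuousAt
    exact ContinuousAt.comp (f := fun q : E × E => q.1 - s • v) (x := (p, X)) h1
      (continuousAt_fst.sub continuousAt_const)
  have hlt : ∀ᶠ q in 𝓝 (p, X), ρ (q.1 - s • v) < 0 :=
    hps.eventually (gt_mem_nhds (by
      have : p + s • -v = p - s • v := by rw [smul_neg, sub_eq_add_neg]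
      rw [this] at hs1
      simpa using hs1))
  filter_upwards [hlt, Metric.ball_mem_nhds (p, X) (half_pos hδ)] with q hq1 hq2 hq3
  have hline : ∀ t : ℝ, HasDerivAt (fun t : ℝ => (q.1 - t • v, q.2)) (-v, (0 : E)) t := fun t => by
    have h1 : HasDerivAt (fun t : ℝ => q.1 - t • v) (-v) t := by
      simpa using ((hasDerivAt_id t).smul_const v).const_sub q.1
    exact h1.prodMk (hasDerivAt_const t q.2)
  have hcont : ContinuousOn (fun t : ℝ => ρ (q.1 - t • v)) (Icc 0 s) := fun t ht => by
    have h1 := (hball _ (hmem q hq2 t ht)).2.2.1.continuousAt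
    exact (ContinuousAt.comp (f := fun t : ℝ => (q.1 - t • v, q.2)) (x := t) h1
      (hline t).continuousAt).continuousWithinAt
  obtain ⟨t, ht, ht0⟩ := intermediate_value_Icc' hs2.le hcont
    (show (0 : ℝ) ∈ Icc _ _ from ⟨hq1.le, by simpa using hq3⟩)
  have hanti : AntitoneOn (fun t : ℝ => F (q.1 - t • v, q.2) - κ * ρ (q.1 - t • v)) (Icc 0 s) := by
    have hd : ∀ t ∈ Icc 0 s, HasDerivAt
        (fun t : ℝ => F (q.1 - t • v, q.2) - κ * ρ (q.1 - t • v))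
        (fderiv ℝ (fun q : E × E => F q - κ * ρ q.1) (q.1 - t • v, q.2) (-v, 0)) t := fun t ht =>
      HasFDerivAt.comp_hasDerivAt (l := fun q : E × E => F q - κ * ρ q.1) t
        ((hball _ (hmem q hq2 t ht)).1.differentiableAt (by norm_num)).hasFDerivAt (hline t)
    refine antitoneOn_of_deriv_nonpos (convex_Icc 0 s)
      (fun t ht => (hd t ht).continuousAt.continuousWithinAt)
      (fun t ht => (hd t (interior_subset ht)).differentiableAt.differentiableWithinAt)
      fun t ht => ?_
    rw [(hd t (interior_subset ht)).deriv, show ((-v, 0) : E × E) = -(v, 0) by simp, map_neg]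
    exact neg_nonpos.2 (hball _ (hmem q hq2 t (interior_subset ht))).2.1.le
  have h1 := hanti ⟨le_rfl, hs2.le⟩ ht ht.1
  have h2 := (hball _ (hmem q hq2 t ht)).2.2.2 ht0
  simp only [zero_smul, sub_zero, Prod.mk.eta] at h1
  have h3 : ρ (q.1 - t • v) = 0 := ht0
  rw [h3] at h1
  linarith

/-- The complex gradient `(∂ρ/∂z̄_k)_k`, a positive multiple of `nfield ρ p`. -/
def cgrad {n : ℕ} (ρ : (Fin n → ℂ) → ℝ) (p : Fin n → ℂ) : Fin n → ℂ :=
  fun k => dzbar k (cplx ρ) p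

/-- The squared Euclidean norm of the complex gradient. -/
def cgradSq {n : ℕ} (ρ : (Fin n → ℂ) → ℝ) (p : Fin n → ℂ) : ℝ :=
  ∑ k, normSq (dz k (cplx ρ) p)

section Gradient

variable {n : ℕ} {ρ : (Fin n → ℂ) → ℝ} {p : Fin n → ℂ}

theorem dz_cplx_eq_conj_dzbar (h : DifferentiableAt ℝ ρ p) (k : Fin n) :
    dz k (cplx ρ) p = (starRingEnd ℂ) (dzbar k (cplx ρ) p) := by
  rw [dz, dzbar, fderiv_cplx h, fderiv_cplx h]
  simp [sub_eq_add_neg, map_ofNat (starRingEnd ℂ) 2]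

theorem dirDeriv_cgrad (h : DifferentiableAt ℝ ρ p) :
    dirDeriv (cgrad ρ p) (cplx ρ) p = (cgradSq ρ p : ℂ) := by
  rw [dirDeriv, cgradSq, Complex.ofReal_sum]
  refine Finset.sum_congr rfl fun k _ => ?_
  rw [Complex.normSq_eq_conj_mul_self, dz_cplx_eq_conj_dzbar h, Complex.conj_conj, cgrad]

theorem fderiv_cgrad (h : DifferentiableAt ℝ ρ p) :
    fderiv ℝ ρ p (cgrad ρ p) = 2 * cgradSq ρ p := by
  have := congrArg Complex.re (dirDeriv_cgrad h)
  rw [dirDeriv_cplx_re h, Complex.ofReal_re] at this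
  linarith

theorem normSq_dz_cplx (h : DifferentiableAt ℝ ρ p) (k : Fin n) :
    normSq (dz k (cplx ρ) p) =
      (fderiv ℝ ρ p (Pi.single k 1) ^ 2 + fderiv ℝ ρ p (Pi.single k I) ^ 2) / 4 := by
  rw [dz, fderiv_cplx h, fderiv_cplx h, Complex.normSq_div, Complex.normSq_apply]
  simp
  ring

theorem gradNorm_eq (h : DifferentiableAt ℝ ρ p) : gradNorm ρ p = 2 * √(cgradSq ρ p) := by
  have e : (∑ j, ((fderiv ℝ ρ p (Pi.single j 1)) ^ 2 +
      (fderiv ℝ ρ p (Pi.single j Complex.I)) ^ 2)) = 2 ^ 2 * cgradSq ρ p := by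
    rw [cgradSq, Finset.mul_sum]
    exact Finset.sum_congr rfl fun j _ => by rw [normSq_dz_cplx h]; ring
  rw [gradNorm, e, Real.sqrt_mul (by positivity), Real.sqrt_sq (by norm_num)]

theorem cgradSq_pos (h : DifferentiableAt ℝ ρ p) (hd : fderiv ℝ ρ p ≠ 0) : 0 < cgradSq ρ p := by
  have hnn : ∀ k ∈ Finset.univ, 0 ≤ normSq (dz k (cplx ρ) p) := fun k _ => Complex.normSq_nonneg _
  refine lt_of_le_of_ne (Finset.sum_nonneg hnn) fun h0 => hd ?_
  have h1 := (Finset.sum_eq_zero_iff_of_nonneg hnn).1 h0.symm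
  ext X
  have h2 := map_pi_complex (fderiv ℝ ρ p).toLinearMap X
  rw [ContinuousLinearMap.coe_coe] at h2
  rw [h2, zero_apply]
  refine Finset.sum_eq_zero fun k hk => ?_
  have h3 := h1 k hk
  rw [normSq_dz_cplx h] at h3
  have h4 : fderiv ℝ ρ p (Pi.single k 1) = 0 := by nlinarith
  have h5 : fderiv ℝ ρ p (Pi.single k I) = 0 := by nlinarith
  simp [h4, h5]

theorem nfield_eq : nfield ρ p = ((√(cgradSq ρ p) : ℝ) : ℂ)⁻¹ • cgrad ρ p := rfl

theorem dirDeriv_re_of_real {f : (Fin n → ℂ) → ℂ} (hf : DifferentiableAt ℝ f p)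
    (him : ∀ᶠ w in 𝓝 p, (f w).im = 0) (v : Fin n → ℂ) :
    (dirDeriv v f p).re = fderiv ℝ (fun w => (f w).re) p v / 2 := by
  have hre : DifferentiableAt ℝ (fun w => (f w).re) p :=
    Complex.reCLM.differentiableAt.comp p hf
  rw [← dirDeriv_cplx_re hre, dirDeriv_eq_fderiv, dirDeriv_eq_fderiv]
  have : f =ᶠ[𝓝 p] cplx fun w => (f w).re := by
    filter_upwards [him] with w hw
    exact Complex.ext rfl hw
  rw [this.fderiv_eq]

theorem keyIneqAt_iff {L : (Fin n → ℂ) → (Fin n → ℂ)} {η : ℝ} (hη : 1 < η)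
    (hρ : DifferentiableAt ℝ ρ p) (hm : 0 < cgradSq ρ p)
    (hf : DifferentiableAt ℝ (fun w => levi ρ (L w) (L w) w) p)
    (him : ∀ᶠ w in 𝓝 p, (levi ρ (L w) (L w) w).im = 0) :
    keyIneqAt ρ L η p ↔ normSq (levi ρ (L p) (cgrad ρ p) p) ≤
      (η - 1) * cgradSq ρ p *
        (fderiv ℝ (fun w => (levi ρ (L w) (L w) w).re) p (cgrad ρ p) / 2) := by
  rw [← dirDeriv_re_of_real hf him]
  have hs : √(cgradSq ρ p) * √(cgradSq ρ p) = cgradSq ρ p := Real.mul_self_sqrt hm.le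
  have hs0 : 0 < √(cgradSq ρ p) := Real.sqrt_pos.2 hm
  have e1 : normSq (levi ρ (L p) (nfield ρ p) p) =
      normSq (levi ρ (L p) (cgrad ρ p) p) / cgradSq ρ p := by
    have := levi_smul_smul ρ p (L p) (cgrad ρ p) 1 ((√(cgradSq ρ p) : ℝ) : ℂ)⁻¹
    rw [one_smul, one_mul] at this
    rw [nfield_eq, this, Complex.normSq_mul, Complex.normSq_conj, Complex.normSq_inv,
      Complex.normSq_ofReal, hs]
    ring
  have e2 : (fieldDeriv (nfield ρ) (fun w => levi ρ (L w) (L w) w) p).re =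
      (dirDeriv (cgrad ρ p) (fun w => levi ρ (L w) (L w) w) p).re / √(cgradSq ρ p) := by
    rw [fieldDeriv, nfield_eq, dirDeriv_smul, ← Complex.ofReal_inv, Complex.re_ofReal_mul]
    ring
  rw [keyIneqAt, e1, e2, gradNorm_eq hρ]
  generalize normSq (levi ρ (L p) (cgrad ρ p) p) = A
  generalize (dirDeriv (cgrad ρ p) (fun w => levi ρ (L w) (L w) w) p).re = R
  generalize cgradSq ρ p = m at *
  have hη' : 0 < η - 1 := sub_pos.2 hη
  have e3 : 1 / (η - 1) * (A / m) / (2 * √m) ^ 2 - 1 / 2 * (R / √m) / (2 * √m) =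
      (A - (η - 1) * m * R) / (4 * (η - 1) * m ^ 2) := by
    rw [mul_pow, pow_two √m, hs, show 1 / 2 * (R / √m) / (2 * √m) = R / (4 * (√m * √m)) by
      field_simp; ring, hs]
    field_simp
    ring
  rw [e3, div_le_iff₀ (by positivity), zero_mul, sub_nonpos]

end Gradient

section Smoothness

variable {n : ℕ} {G : Type*} [NormedAddCommGroup G] [NormedSpace ℝ G]

theorem ContDiffAt.cplx {ρ : (Fin n → ℂ) → ℝ} {z : Fin n → ℂ}
    (h : ContDiffAt ℝ (⊤ : ℕ∞) ρ z) : ContDiffAt ℝ (⊤ : ℕ∞) (_root_.cplx ρ) z :=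
  Complex.ofRealCLM.contDiff.contDiffAt.comp z h

theorem ContDiffAt.dz {f : (Fin n → ℂ) → ℂ} {z : Fin n → ℂ} (h : ContDiffAt ℝ (⊤ : ℕ∞) f z)
    (j : Fin n) : ContDiffAt ℝ (⊤ : ℕ∞) (fun w => _root_.dz j f w) z := by
  have h1 : ContDiffAt ℝ (⊤ : ℕ∞) (fderiv ℝ f) z := h.fderiv_right (by simp)
  have h2 : ∀ e, ContDiffAt ℝ (⊤ : ℕ∞) (fun w => fderiv ℝ f w e) z :=
    fun e => h1.clm_apply contDiffAt_const
  simp only [_root_.dz, div_eq_mul_inv]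
  exact ((h2 _).sub (contDiffAt_const.mul (h2 _))).mul contDiffAt_const

theorem ContDiffAt.dzbar {f : (Fin n → ℂ) → ℂ} {z : Fin n → ℂ} (h : ContDiffAt ℝ (⊤ : ℕ∞) f z)
    (j : Fin n) : ContDiffAt ℝ (⊤ : ℕ∞) (fun w => _root_.dzbar j f w) z := by
  have h1 : ContDiffAt ℝ (⊤ : ℕ∞) (fderiv ℝ f) z := h.fderiv_right (by simp)
  have h2 : ∀ e, ContDiffAt ℝ (⊤ : ℕ∞) (fun w => fderiv ℝ f w e) z :=
    fun e => h1.clm_apply contDiffAt_const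
  simp only [_root_.dzbar, div_eq_mul_inv]
  exact ((h2 _).add (contDiffAt_const.mul (h2 _))).mul contDiffAt_const

theorem ContDiffAt.levi {ρ : (Fin n → ℂ) → ℝ} {X Y a : G → Fin n → ℂ} {q : G}
    (hρ : ContDiffAt ℝ (⊤ : ℕ∞) ρ (a q)) (hX : ContDiffAt ℝ (⊤ : ℕ∞) X q)
    (hY : ContDiffAt ℝ (⊤ : ℕ∞) Y q) (ha : ContDiffAt ℝ (⊤ : ℕ∞) a q) :
    ContDiffAt ℝ (⊤ : ℕ∞) (fun q => _root_.levi ρ (X q) (Y q) (a q)) q := by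
  refine ContDiffAt.sum fun j _ => ContDiffAt.sum fun k _ => ?_
  refine (ContDiffAt.mul ?_ (contDiffAt_pi.1 hX j)).mul ?_
  · exact ((hρ.cplx.dzbar k).dz j).comp q ha
  · exact Complex.conjCLE.contDiff.contDiffAt.comp q (contDiffAt_pi.1 hY k)

theorem ContDiffAt.dirDeriv {f : (Fin n → ℂ) → ℂ} {X a : G → Fin n → ℂ} {q : G}
    (hf : ContDiffAt ℝ (⊤ : ℕ∞) f (a q)) (hX : ContDiffAt ℝ (⊤ : ℕ∞) X q)
    (ha : ContDiffAt ℝ (⊤ : ℕ∞) a q) :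
    ContDiffAt ℝ (⊤ : ℕ∞) (fun q => _root_.dirDeriv (X q) f (a q)) q :=
  ContDiffAt.sum fun j _ => (contDiffAt_pi.1 hX j).mul ((hf.dz j).comp q ha)

theorem ContDiffAt.complex_re {f : G → ℂ} {q : G} (hf : ContDiffAt ℝ (⊤ : ℕ∞) f q) :
    ContDiffAt ℝ (⊤ : ℕ∞) (fun q => (f q).re) q :=
  Complex.reCLM.contDiff.contDiffAt.comp q hf

theorem ContDiffAt.differentiableAt_of_top {G' : Type*} [NormedAddCommGroup G']
    [NormedSpace ℝ G'] {f : G → G'} {q : G} (hf : ContDiffAt ℝ (⊤ : ℕ∞) f q) :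
    DifferentiableAt ℝ f q :=
  hf.differentiableAt (by simp)

end Smoothness

theorem fderiv_add_mul_nonneg {E : Type*} [NormedAddCommGroup E] [NormedSpace ℝ E]
    {g ρ K : E → ℝ} {p v : E} (hg : DifferentiableAt ℝ g p) (hρ : DifferentiableAt ℝ ρ p)
    (hK : ContinuousAt K p) (hg0 : g p = 0) (hρ0 : ρ p = 0)
    (h : ∀ᶠ t in 𝓝[>] (0 : ℝ), 0 ≤ g (p + t • v) + ρ (p + t • v) * K (p + t • v)) :
    0 ≤ fderiv ℝ g p v + fderiv ℝ ρ p v * K p := by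
  have slope : ∀ f : E → ℝ, DifferentiableAt ℝ f p → f p = 0 →
      Tendsto (fun t : ℝ => t⁻¹ * f (p + t • v)) (𝓝[>] 0) (𝓝 (fderiv ℝ f p v)) := by
    intro f hf h0
    have h1 := (hf.hasFDerivAt.hasLineDerivAt v).tendsto_slope_zero_right
    simpa [h0] using h1
  refine ge_of_tendsto ((slope g hg hg0).add
    ((slope ρ hρ hρ0).mul (hK.tendsto.comp (tendsto_line p v)))) ?_
  filter_upwards [h, eventually_mem_nhdsWithin] with t ht ht0
  have : 0 ≤ t⁻¹ * (g (p + t • v) + ρ (p + t • v) * K (p + t • v)) :=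
    mul_nonneg (inv_nonneg.2 (le_of_lt ht0)) ht
  simp only [Function.comp]
  linarith

theorem steinExpSet_subset_etaRhoSet {n : ℕ} {Ω U V : Set (Fin n → ℂ)} {ρ : (Fin n → ℂ) → ℝ}
    (hΩ : IsOpen Ω) (hU : IsOpen U) (hfr : frontier Ω ⊆ U) (hρ : IsDefFn Ω V ρ) :
    steinExpSet Ω ρ ⊆ etaRhoSet Ω U ρ := by
  rintro η ⟨hη, W, hW, hfW, hpsh⟩
  refine ⟨hη, fun L hL p hp hlev => ?_⟩
  have hpV := hρ.frontier_subset hp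
  have hρp := hρ.contDiffAt hpV
  have hd := hρ.differentiableAt hpV
  have hm := cgradSq_pos hd (hρ.grad_ne p hp)
  have hLp : ContDiffAt ℝ (⊤ : ℕ∞) L p := hL.1.contDiffAt (hU.mem_nhds (hfr hp))
  have hlevp : ContDiffAt ℝ (⊤ : ℕ∞) (fun w => levi ρ (L w) (L w) w) p :=
    hρp.levi hLp hLp contDiffAt_id
  rw [keyIneqAt_iff hη hd hm hlevp.differentiableAt_of_top (by
    filter_upwards [hρ.isOpen.mem_nhds hpV] with w hw
    exact levi_self_im (hρ.contDiffAt_two hw) _)]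
  set v := cgrad ρ p with hv
  set m := cgradSq ρ p with hm_def
  set l := levi ρ (L p) v p with hl
  have hη' : 0 < η - 1 := sub_pos.2 hη
  have key : ∀ b : ℂ, 0 ≤ fderiv ℝ (fun w => (levi ρ (L w) (L w) w).re) p v +
      fderiv ℝ ρ p v * (2 * ((starRingEnd ℂ) b * levi ρ (L p) v p).re +
        ρ p * normSq b * (levi ρ v v p).re +
        (η - 1) * (normSq b * normSq (dirDeriv v (cplx ρ) p))) := by
    intro b
    have hc : ContinuousAt (fun z => 2 * ((starRingEnd ℂ) b * levi ρ (L z) v z).re +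
        ρ z * normSq b * (levi ρ v v z).re +
        (η - 1) * (normSq b * normSq (dirDeriv v (cplx ρ) z))) p := by
      have c1 : ContinuousAt (fun z => levi ρ (L z) v z) p :=
        (hρp.levi hLp contDiffAt_const contDiffAt_id).continuousAt
      have c2 : ContinuousAt (fun z => levi ρ v v z) p :=
        (hρp.levi contDiffAt_const contDiffAt_const contDiffAt_id).continuousAt
      have c3 : ContinuousAt (fun z => dirDeriv v (cplx ρ) z) p :=
        (hρp.cplx.dirDeriv contDiffAt_const contDiffAt_id).continuousAt
      have c4 := hρp.continuousAt
      have c5 : ContinuousAt (fun z => normSq (dirDeriv v (cplx ρ) z)) p :=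
        Complex.continuous_normSq.continuousAt.comp c3
      have c6 : ContinuousAt (fun z => ((starRingEnd ℂ) b * levi ρ (L z) v z).re) p :=
        Complex.continuous_re.continuousAt.comp (continuousAt_const.mul c1)
      have c7 : ContinuousAt (fun z => (levi ρ v v z).re) p :=
        Complex.continuous_re.continuousAt.comp c2
      fun_prop
    refine fderiv_add_mul_nonneg hlevp.complex_re.differentiableAt_of_top hd hc
      (by rw [hlev, Complex.zero_re]) (hρ.eq_zero hΩ hp) ?_
    filter_upwards [eventually_pos_along_line hd (hρ.eq_zero hΩ hp) (v := v)
        (by rw [hv, fderiv_cgrad hd]; linarith),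
      (tendsto_line p v).eventually (hρ.isOpen.mem_nhds hpV),
      (tendsto_line p v).eventually (hW.mem_nhds (hfW hp)),
      (tendsto_line p v).eventually (hU.mem_nhds (hfr hp))] with t hpos hV hW hU
    generalize p + t • v = z at *
    have h2 := hρ.contDiffAt_two hV
    have hY : 0 ≤ ρ z * (levi ρ (L z + ((ρ z : ℂ) * b) • v) (L z + ((ρ z : ℂ) * b) • v) z).re +
        (η - 1) * normSq (dirDeriv (L z + ((ρ z : ℂ) * b) • v) (cplx ρ) z) := by
      generalize L z + ((ρ z : ℂ) * b) • v = Y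
      by_cases hY : Y = 0
      · simp [hY, levi, dirDeriv]
      · exact ((levi_rpow_self_re_pos_iff h2 hpos (by linarith) Y).1
          (hpsh z ⟨hρ.notMem_closure hV hpos, hW⟩ Y hY)).le
    rw [levi_self_add_smul_re h2, dirDeriv_add, dirDeriv_smul, hL.2 z hU, zero_add, map_mul,
      Complex.conj_ofReal, mul_assoc, Complex.re_ofReal_mul, Complex.normSq_mul,
      Complex.normSq_mul, Complex.normSq_mul, Complex.normSq_ofReal] at hY
    refine (mul_nonneg_iff_of_pos_left hpos).1 (hY.trans_eq ?_)
    ring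
  have h := key (-l / (((η - 1) * m ^ 2 : ℝ) : ℂ))
  rw [hρ.eq_zero hΩ hp, hv, fderiv_cgrad hd, dirDeriv_cgrad hd, ← hv, ← hl, ← hm_def,
    Complex.normSq_div, Complex.normSq_neg, Complex.normSq_ofReal, Complex.normSq_ofReal, map_div₀,
    Complex.conj_ofReal, map_neg, div_mul_eq_mul_div, neg_mul, ← Complex.normSq_eq_conj_mul_self,
    ← Complex.ofReal_neg, ← Complex.ofReal_div, Complex.ofReal_re] at h
  generalize fderiv ℝ (fun w => (levi ρ (L w) (L w) w).re) p v = D at *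
  generalize normSq l = A at *
  have e : D + 2 * m * (2 * (-A / ((η - 1) * m ^ 2)) + 0 * (A / ((η - 1) * m ^ 2 *
      ((η - 1) * m ^ 2))) * (levi ρ v v p).re + (η - 1) * (A / ((η - 1) * m ^ 2 *
      ((η - 1) * m ^ 2)) * (m * m))) = (2 / ((η - 1) * m)) * ((η - 1) * m * (D / 2) - A) := by
    field_simp
    ring
  rw [e] at h
  have := (mul_nonneg_iff_of_pos_left (by positivity)).1 h
  linarith

/-- The projection of `Y` to the kernel of `∂ρ(z)` along `v`. -/
def tangentProj {n : ℕ} (ρ : (Fin n → ℂ) → ℝ) (v z Y : Fin n → ℂ) : Fin n → ℂ :=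
  Y + (-(dirDeriv Y (cplx ρ) z / dirDeriv v (cplx ρ) z)) • v

section TangentProj

variable {n : ℕ} {ρ : (Fin n → ℂ) → ℝ} {v z : Fin n → ℂ}

theorem dirDeriv_tangentProj (h : dirDeriv v (cplx ρ) z ≠ 0) (Y : Fin n → ℂ) :
    dirDeriv (tangentProj ρ v z Y) (cplx ρ) z = 0 := by
  rw [tangentProj, dirDeriv_add, dirDeriv_smul]
  field_simp
  ring

theorem tangentProj_of_dirDeriv_eq_zero {Y : Fin n → ℂ} (h : dirDeriv Y (cplx ρ) z = 0) :
    tangentProj ρ v z Y = Y := by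
  simp [tangentProj, h]

theorem tangentProj_add_smul (Y : Fin n → ℂ) :
    tangentProj ρ v z Y + (dirDeriv Y (cplx ρ) z / dirDeriv v (cplx ρ) z) • v = Y := by
  rw [tangentProj, neg_smul, neg_add_cancel_right]

theorem ContDiffAt.tangentProj {G : Type*} [NormedAddCommGroup G] [NormedSpace ℝ G]
    {Y a : G → Fin n → ℂ} {q : G} (hρ : ContDiffAt ℝ (⊤ : ℕ∞) ρ (a q))
    (hv : _root_.dirDeriv v (_root_.cplx ρ) (a q) ≠ 0) (hY : ContDiffAt ℝ (⊤ : ℕ∞) Y q)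
    (ha : ContDiffAt ℝ (⊤ : ℕ∞) a q) :
    ContDiffAt ℝ (⊤ : ℕ∞) (fun q => _root_.tangentProj ρ v (a q) (Y q)) q := by
  simp only [_root_.tangentProj, div_eq_mul_inv]
  exact hY.add (((hρ.cplx.dirDeriv hY ha).mul
    ((hρ.cplx.dirDeriv contDiffAt_const ha).inv hv)).neg.smul contDiffAt_const)

/-- Every vector extends to a smooth tangent field given by `tangentProj` near `p`. -/
theorem exists_isTangentField {V U : Set (Fin n → ℂ)} {p : Fin n → ℂ} (hV : IsOpen V)
    (hρ : ContDiffOn ℝ (⊤ : ℕ∞) ρ V) (hp : p ∈ V) (hv : dirDeriv v (cplx ρ) p ≠ 0)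
    (X : Fin n → ℂ) :
    ∃ L, IsTangentField ρ L U ∧ ∀ᶠ z in 𝓝 p, L z = tangentProj ρ v z X := by
  have hsm : ∀ z ∈ V, ContDiffAt ℝ (⊤ : ℕ∞) ρ z := fun z hz => hρ.contDiffAt (hV.mem_nhds hz)
  have hc : ContinuousAt (fun z => dirDeriv v (cplx ρ) z) p :=
    ((hsm p hp).cplx.dirDeriv contDiffAt_const contDiffAt_id).continuousAt
  obtain ⟨ε, hε, hball⟩ := Metric.eventually_nhds_iff_ball.1
    ((hV.eventually_mem hp).and (hc.eventually_ne hv))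
  let χ : ContDiffBump p := ⟨ε / 4, ε / 2, by linarith, by linarith⟩
  refine ⟨fun z => (χ z : ℂ) • tangentProj ρ v z X, ⟨fun z _ => ?_, fun z _ => ?_⟩, ?_⟩
  · refine ContDiffAt.contDiffWithinAt ?_
    by_cases hz : z ∈ Metric.ball p ε
    · exact (Complex.ofRealCLM.contDiff.contDiffAt.comp z χ.contDiffAt).smul
        ((hsm z (hball z hz).1).tangentProj (hball z hz).2 contDiffAt_const contDiffAt_id)
    · have hz' : z ∈ (Metric.closedBall p (ε / 2))ᶜ := fun h => hz
        (Metric.closedBall_subset_ball (by linarith) h)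
      refine (contDiffAt_const (c := (0 : Fin n → ℂ))).congr_of_eventuallyEq ?_
      filter_upwards [Metric.isClosed_closedBall.isOpen_compl.mem_nhds hz'] with w hw
      have : χ w = 0 := χ.zero_of_le_dist (le_of_lt (not_le.1 hw))
      simp [this]
  · rw [dirDeriv_smul]
    by_cases hz : z ∈ Metric.ball p ε
    · rw [dirDeriv_tangentProj (hball z hz).2, mul_zero]
    · have : χ z = 0 := χ.zero_of_le_dist ((by linarith : ε / 2 ≤ ε).trans (not_lt.1 hz))
      simp [this]
  · filter_upwards [χ.eventuallyEq_one] with z hz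
    simp [hz]

end TangentProj

section LocalEstimate

variable {n : ℕ} {Ω U V : Set (Fin n → ℂ)} {ρ : (Fin n → ℂ) → ℝ} {η ε : ℝ} {p X : Fin n → ℂ}

theorem levi_tangentProj_ge (hΩ : IsOpen Ω) (hρ : IsDefFn Ω V ρ)
    (hps : ∀ p ∈ frontier Ω, LeviPseudoconvexAt ρ p) (hη : η ∈ etaRhoSet Ω U ρ) (hε : 0 < ε)
    (hp : p ∈ frontier Ω) (hX : dirDeriv X (cplx ρ) p = 0) :
    ∀ᶠ q in 𝓝 (p, X), 0 ≤ ρ q.1 →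
      (normSq (levi ρ X (cgrad ρ p) p) / ((η - 1) * cgradSq ρ p ^ 2) - ε) * ρ q.1 ≤
        (levi ρ (tangentProj ρ (cgrad ρ p) q.1 q.2)
          (tangentProj ρ (cgrad ρ p) q.1 q.2) q.1).re := by
  have hpV := hρ.frontier_subset hp
  have hρp := hρ.contDiffAt hpV
  have hd := hρ.differentiableAt hpV
  have h0 := hρ.eq_zero hΩ hp
  have hm := cgradSq_pos hd (hρ.grad_ne p hp)
  have hη' : 0 < η - 1 := sub_pos.2 hη.1
  have hv0 : dirDeriv (cgrad ρ p) (cplx ρ) p ≠ 0 := by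
    rw [dirDeriv_cgrad hd]; exact_mod_cast hm.ne'
  set v := cgrad ρ p with hv
  set m := cgradSq ρ p with hm_def
  set F : (Fin n → ℂ) × (Fin n → ℂ) → ℝ :=
    fun q => (levi ρ (tangentProj ρ v q.1 q.2) (tangentProj ρ v q.1 q.2) q.1).re with hF
  have hP : ContDiffAt ℝ (⊤ : ℕ∞) (fun q : (Fin n → ℂ) × (Fin n → ℂ) =>
      tangentProj ρ v q.1 q.2) (p, X) :=
    ContDiffAt.tangentProj (q := (p, X)) hρp hv0 contDiffAt_snd contDiffAt_fst
  have hFs : ContDiffAt ℝ (⊤ : ℕ∞) F (p, X) :=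
    (ContDiffAt.levi (q := (p, X)) (a := Prod.fst) hρp hP hP contDiffAt_fst).complex_re
  have hfst : Tendsto (Prod.fst : (Fin n → ℂ) × (Fin n → ℂ) → _) (𝓝 (p, X)) (𝓝 p) :=
    continuous_fst.continuousAt
  have hFX : F (p, X) = (levi ρ X X p).re := by
    simp only [hF, tangentProj_of_dirDeriv_eq_zero hX]
  have hFnn : 0 ≤ F (p, X) := hFX ▸ hps p hp X hX
  rcases hFnn.eq_or_lt' with hF0 | hFpos
  · refine eventually_mul_le_of_nonneg_on_zeros (v := v) (hFs.of_le (by simp)) (hρp.of_le (by simp))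
      h0 (by rw [hv, fderiv_cgrad hd]; positivity) ?_ ?_
    · have hlev : levi ρ X X p = 0 :=
        Complex.ext (hFX ▸ hF0) (levi_self_im (hρ.contDiffAt_two hpV) X)
      obtain ⟨L, hL, hLX⟩ := exists_isTangentField (U := univ) hρ.isOpen hρ.smooth hpV
        hv0 X
      have hLs : ContDiffAt ℝ (⊤ : ℕ∞) L p :=
        hL.1.contDiffAt univ_mem
      have hLp : L p = X := by
        rw [hLX.self_of_nhds, tangentProj_of_dirDeriv_eq_zero hX]
      have hkey := hη.2 L ⟨hL.1.mono (subset_univ U), fun z _ => hL.2 z trivial⟩ p hp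
        (by rw [hLp, hlev])
      rw [keyIneqAt_iff hη.1 hd hm
        (hρp.levi hLs hLs contDiffAt_id).differentiableAt_of_top (by
          filter_upwards [hρ.isOpen.mem_nhds hpV] with w hw
          exact levi_self_im (hρ.contDiffAt_two hw) _), hLp, ← hv, ← hm_def] at hkey
      have e1 : (fun w => (levi ρ (L w) (L w) w).re) =ᶠ[𝓝 p] fun w => F (w, X) := by
        filter_upwards [hLX] with w hw
        rw [hw]
      have e2 : fderiv ℝ (fun w => F (w, X)) p v = fderiv ℝ F (p, X) (v, 0) := by
        have := hFs.differentiableAt_of_top.hasFDerivAt.comp p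
          (hasFDerivAt_prodMk_left (𝕜 := ℝ) p X)
        rw [HasFDerivAt.fderiv (f := fun w => F (w, X)) this]
        simp
      rw [e1.fderiv_eq, e2] at hkey
      rw [hv, fderiv_cgrad hd, ← hv, ← hm_def]
      have e3 : normSq (levi ρ X v p) / ((η - 1) * m ^ 2) * (2 * m) ≤
          fderiv ℝ F (p, X) (v, 0) := by
        rw [div_mul_eq_mul_div, div_le_iff₀ (by positivity)]
        nlinarith
      nlinarith [mul_pos hε hm]
    · have c1 : ContinuousAt (fun z => dirDeriv v (cplx ρ) z) p :=
        (hρp.cplx.dirDeriv contDiffAt_const contDiffAt_id).continuousAt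
      have c2 : ContinuousAt (fderiv ℝ ρ) p :=
        (hρp.fderiv_right (m := (⊤ : ℕ∞)) (by simp)).continuousAt
      filter_upwards [hfst.eventually (c1.eventually_ne hv0),
        hfst.eventually (c2.eventually_ne (hρ.grad_ne p hp)),
        hfst.eventually (hρ.isOpen.mem_nhds hpV)] with q h1 h2 h3 h4
      exact hps q.1 (hρ.mem_frontier hΩ h3 h4 h2) _ (dirDeriv_tangentProj h1 _)
  · have c : ContinuousAt (fun q : (Fin n → ℂ) × (Fin n → ℂ) => F q -
        (normSq (levi ρ X v p) / ((η - 1) * m ^ 2) - ε) * ρ q.1) (p, X) :=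
      hFs.continuousAt.sub (continuousAt_const.mul (hρp.continuousAt.tendsto.comp hfst))
    filter_upwards [c.eventually_const_lt (u := 0) (by simpa [h0] using hFpos)] with q hq _
    exact (sub_pos.1 hq).le

theorem eventually_pos_of_mem_etaRhoSet (hΩ : IsOpen Ω) (hρ : IsDefFn Ω V ρ)
    (hps : ∀ p ∈ frontier Ω, LeviPseudoconvexAt ρ p) (hη : η ∈ etaRhoSet Ω U ρ) {a : ℝ}
    (ha : η - 1 < a) (hε : 0 < ε) (hp : p ∈ frontier Ω) :
    ∀ᶠ q in 𝓝 (p, X), 0 < ρ q.1 →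
      0 < ρ q.1 * (levi ρ q.2 q.2 q.1).re + a * normSq (dirDeriv q.2 (cplx ρ) q.1) +
        ε * ρ q.1 ^ 2 := by
  have hpV := hρ.frontier_subset hp
  have hρp := hρ.contDiffAt hpV
  have hd := hρ.differentiableAt hpV
  have h0 := hρ.eq_zero hΩ hp
  have hm := cgradSq_pos hd (hρ.grad_ne p hp)
  have hη' : 0 < η - 1 := sub_pos.2 hη.1
  have hfst : Tendsto (Prod.fst : (Fin n → ℂ) × (Fin n → ℂ) → _) (𝓝 (p, X)) (𝓝 p) :=
    continuous_fst.continuousAt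
  have cρ : ContinuousAt (fun q : (Fin n → ℂ) × (Fin n → ℂ) => ρ q.1) (p, X) :=
    hρp.continuousAt.tendsto.comp hfst
  have cn : ∀ {f : (Fin n → ℂ) × (Fin n → ℂ) → ℂ}, ContDiffAt ℝ (⊤ : ℕ∞) f (p, X) →
      ContinuousAt (fun q => normSq (f q)) (p, X) := fun hf =>
    Complex.continuous_normSq.continuousAt.comp hf.continuousAt
  by_cases hX : dirDeriv X (cplx ρ) p = 0
  · set v := cgrad ρ p with hv
    set m := cgradSq ρ p with hm_def
    set κ := normSq (levi ρ X v p) / ((η - 1) * m ^ 2) with hκ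
    have hvm : dirDeriv v (cplx ρ) p = (m : ℂ) := dirDeriv_cgrad hd
    have hv0 : dirDeriv v (cplx ρ) p ≠ 0 := by rw [hvm]; exact_mod_cast hm.ne'
    have hP : ContDiffAt ℝ (⊤ : ℕ∞) (fun q : (Fin n → ℂ) × (Fin n → ℂ) =>
        tangentProj ρ v q.1 q.2) (p, X) :=
      ContDiffAt.tangentProj (q := (p, X)) hρp hv0 contDiffAt_snd contDiffAt_fst
    have c1 : ContinuousAt (fun q : (Fin n → ℂ) × (Fin n → ℂ) =>
        normSq (levi ρ (tangentProj ρ v q.1 q.2) v q.1)) (p, X) :=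
      cn (ContDiffAt.levi (q := (p, X)) (a := Prod.fst) hρp hP contDiffAt_const contDiffAt_fst)
    have c2 : ContinuousAt (fun q : (Fin n → ℂ) × (Fin n → ℂ) =>
        normSq (dirDeriv v (cplx ρ) q.1)) (p, X) :=
      cn (ContDiffAt.dirDeriv (q := (p, X)) (a := Prod.fst) hρp.cplx contDiffAt_const
        contDiffAt_fst)
    have c3 : ContinuousAt (fun q : (Fin n → ℂ) × (Fin n → ℂ) =>
        (levi ρ v v q.1).re) (p, X) :=
      (ContDiffAt.levi (q := (p, X)) (a := Prod.fst) hρp contDiffAt_const contDiffAt_const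
        contDiffAt_fst).complex_re.continuousAt
    have e1 : normSq (levi ρ (tangentProj ρ v p X) v p) < (η - 1) * m ^ 2 * (κ + ε / 2) := by
      rw [tangentProj_of_dirDeriv_eq_zero hX, mul_add, hκ, mul_div_cancel₀ _ (by positivity)]
      have : 0 < (η - 1) * m ^ 2 * (ε / 2) := by positivity
      linarith
    have e2 : (η - 1) * m ^ 2 <
        ρ p * (levi ρ v v p).re + a * normSq (dirDeriv v (cplx ρ) p) := by
      rw [h0, hvm, Complex.normSq_ofReal]
      nlinarith [mul_pos hm hm]
    filter_upwards [levi_tangentProj_ge hΩ hρ hps hη (half_pos hε) hp hX,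
      c1.eventually_lt_const e1, ((cρ.mul c3).add (c2.const_mul a)).eventually_const_lt e2,
      hfst.eventually (hρ.isOpen.mem_nhds hpV),
      hfst.eventually ((hρp.cplx.dirDeriv (contDiffAt_const (c := v))
        contDiffAt_id).continuousAt.eventually_ne hv0)]
      with q hF hl hB hqV hqv hpos
    replace hF : (κ - ε / 2) * ρ q.1 ≤ _ := hF hpos.le
    replace hB : (η - 1) * m ^ 2 <
      ρ q.1 * (levi ρ v v q.1).re + a * normSq (dirDeriv v (cplx ρ) q.1) := hB
    clear_value κ
    set c := dirDeriv q.2 (cplx ρ) q.1 / dirDeriv v (cplx ρ) q.1 with hc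
    have hdir : dirDeriv q.2 (cplx ρ) q.1 = c * dirDeriv v (cplx ρ) q.1 :=
      (div_mul_cancel₀ _ hqv).symm
    have hlev := levi_self_add_smul_re (hρ.contDiffAt_two hqV) (tangentProj ρ v q.1 q.2) v c
    rw [hc, tangentProj_add_smul, ← hc] at hlev
    rw [hlev, hdir, Complex.normSq_mul]
    generalize levi ρ (tangentProj ρ v q.1 q.2) v q.1 = l at *
    generalize (levi ρ (tangentProj ρ v q.1 q.2) (tangentProj ρ v q.1 q.2) q.1).re = f at *
    generalize (levi ρ v v q.1).re = b at *
    generalize normSq (dirDeriv v (cplx ρ) q.1) = d at *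
    generalize ρ q.1 = r at *
    have hθ : 0 < (η - 1) * m ^ 2 := by positivity
    generalize (η - 1) * m ^ 2 = θ at *
    have hsq := Complex.normSq_nonneg ((r : ℂ) * l + (θ : ℂ) * c)
    have e3 : normSq ((r : ℂ) * l + (θ : ℂ) * c) =
        r ^ 2 * normSq l + 2 * r * θ * ((starRingEnd ℂ) c * l).re + θ ^ 2 * normSq c := by
      simp [Complex.normSq_apply]
      ring
    rw [e3] at hsq
    have h1 : r ^ 2 * normSq l < r ^ 2 * (θ * (κ + ε / 2)) :=
      mul_lt_mul_of_pos_left hl (by positivity)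
    have h2 : θ * normSq c ≤ (r * b + a * d) * normSq c :=
      mul_le_mul_of_nonneg_right hB.le (Complex.normSq_nonneg c)
    have h3 : r * ((κ - ε / 2) * r) ≤ r * f := mul_le_mul_of_nonneg_left hF hpos.le
    have h4 : 0 < r ^ 2 * (κ + ε / 2) + 2 * r * ((starRingEnd ℂ) c * l).re + θ * normSq c := by
      refine (mul_pos_iff_of_pos_left hθ).1 (hsq.trans_lt ?_)
      nlinarith
    nlinarith
  · have hs : ContDiffAt ℝ (⊤ : ℕ∞) (fun q : (Fin n → ℂ) × (Fin n → ℂ) =>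
        levi ρ q.2 q.2 q.1) (p, X) :=
      ContDiffAt.levi (q := (p, X)) (a := Prod.fst) hρp contDiffAt_snd contDiffAt_snd contDiffAt_fst
    have c2 : ContinuousAt (fun q : (Fin n → ℂ) × (Fin n → ℂ) =>
        normSq (dirDeriv q.2 (cplx ρ) q.1)) (p, X) :=
      cn (ContDiffAt.dirDeriv (q := (p, X)) (a := Prod.fst) hρp.cplx contDiffAt_snd
        contDiffAt_fst)
    have c := ((cρ.mul hs.complex_re.continuousAt).add (c2.const_mul a)).add
      ((cρ.pow 2).const_mul ε)
    have : 0 < a * normSq (dirDeriv X (cplx ρ) p) :=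
      mul_pos (hη'.trans ha) (Complex.normSq_pos.2 hX)
    filter_upwards [c.eventually_const_lt (u := 0) (by simpa [h0] using this)] with q hq _
    exact hq

end LocalEstimate

section EuclideanNorm

variable {n : ℕ}

theorem norm_sq_le_enormSq (X : Fin n → ℂ) : ‖X‖ ^ 2 ≤ enormSq X := by
  have h0 : 0 ≤ enormSq X := Finset.sum_nonneg fun j _ => Complex.normSq_nonneg (X j)
  have h1 : ‖X‖ ≤ √(enormSq X) := by
    refine (pi_norm_le_iff_of_nonneg (Real.sqrt_nonneg _)).2 fun j => Real.le_sqrt_of_sq_le ?_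
    rw [← Complex.normSq_eq_norm_sq]
    exact Finset.single_le_sum (f := fun j => normSq (X j))
      (fun k _ => Complex.normSq_nonneg (X k)) (Finset.mem_univ j)
  calc ‖X‖ ^ 2 ≤ √(enormSq X) ^ 2 := by gcongr
    _ = enormSq X := Real.sq_sqrt h0

theorem enormSq_nonneg (X : Fin n → ℂ) : 0 ≤ enormSq X :=
  (sq_nonneg _).trans (norm_sq_le_enormSq X)

theorem enormSq_pos {X : Fin n → ℂ} (hX : X ≠ 0) : 0 < enormSq X :=
  (pow_pos (norm_pos_iff.2 hX) 2).trans_le (norm_sq_le_enormSq X)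

theorem contDiff_enormSq : ContDiff ℝ (⊤ : ℕ∞) (enormSq : (Fin n → ℂ) → ℝ) := by
  refine ContDiff.sum fun j _ => ?_
  simp only [Complex.normSq_apply]
  have hr : ContDiff ℝ (⊤ : ℕ∞) fun z : Fin n → ℂ => (z j).re :=
    Complex.reCLM.contDiff.comp (contDiff_apply ℝ ℂ j)
  have hi : ContDiff ℝ (⊤ : ℕ∞) fun z : Fin n → ℂ => (z j).im :=
    Complex.imCLM.contDiff.comp (contDiff_apply ℝ ℂ j)
  exact (hr.mul hr).add (hi.mul hi)

theorem fderiv_enormSq (z X : Fin n → ℂ) :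
    fderiv ℝ enormSq z X = ∑ j, 2 * ((starRingEnd ℂ) (z j) * X j).re := by
  have hr : ∀ j, HasFDerivAt (fun z : Fin n → ℂ => (z j).re)
      (Complex.reCLM.comp (ContinuousLinearMap.proj (R := ℝ) (φ := fun _ : Fin n => ℂ) j)) z :=
    fun j => (Complex.reCLM.comp
      (ContinuousLinearMap.proj (R := ℝ) (φ := fun _ : Fin n => ℂ) j)).hasFDerivAt
  have hi : ∀ j, HasFDerivAt (fun z : Fin n → ℂ => (z j).im)
      (Complex.imCLM.comp (ContinuousLinearMap.proj (R := ℝ) (φ := fun _ : Fin n => ℂ) j)) z :=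
    fun j => (Complex.imCLM.comp
      (ContinuousLinearMap.proj (R := ℝ) (φ := fun _ : Fin n => ℂ) j)).hasFDerivAt
  have h := HasFDerivAt.fun_sum (u := Finset.univ) fun j _ =>
    ((hr j).fun_mul (hr j)).fun_add ((hi j).fun_mul (hi j))
  have e : (enormSq : (Fin n → ℂ) → ℝ) =
      fun z => ∑ j, ((z j).re * (z j).re + (z j).im * (z j).im) := rfl
  rw [e, HasFDerivAt.fderiv h, sum_apply]
  refine Finset.sum_congr rfl fun j _ => ?_
  simp
  ring

theorem dzbar_cplx_enormSq (z : Fin n → ℂ) (k : Fin n) : dzbar k (cplx enormSq) z = z k := by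
  have hd : DifferentiableAt ℝ enormSq z := contDiff_enormSq.differentiable (by simp) z
  rw [dzbar, fderiv_cplx hd, fderiv_cplx hd, fderiv_enormSq, fderiv_enormSq,
    Finset.sum_eq_single k (fun j _ hj => by simp [hj]) (by simp),
    Finset.sum_eq_single k (fun j _ hj => by simp [hj]) (by simp)]
  apply Complex.ext <;> simp

theorem dz_apply (z : Fin n → ℂ) (j k : Fin n) :
    dz j (fun w => w k) z = if j = k then 1 else 0 := by
  have : fderiv ℝ (fun w : Fin n → ℂ => w k) z = ContinuousLinearMap.proj k :=
    (ContinuousLinearMap.proj (R := ℝ) (φ := fun _ : Fin n => ℂ) k).hasFDerivAt.fderiv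
  rw [dz, this]
  split_ifs with h
  · subst h
    simp
  · simp [Ne.symm h]

theorem levi_enormSq (X z : Fin n → ℂ) : levi enormSq X X z = (enormSq X : ℂ) := by
  simp only [levi, dzbar_cplx_enormSq, dz_apply, enormSq, Complex.ofReal_sum,
    Complex.normSq_eq_conj_mul_self]
  refine Finset.sum_congr rfl fun j _ => ?_
  simp [mul_comm]

theorem normSq_dirDeriv_enormSq_le (X z : Fin n → ℂ) :
    normSq (dirDeriv X (cplx enormSq) z) ≤ enormSq X * enormSq z := by
  have hd : DifferentiableAt ℝ enormSq z := contDiff_enormSq.differentiable (by simp) z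
  have e : dirDeriv X (cplx enormSq) z = ∑ j, X j * (starRingEnd ℂ) (z j) :=
    Finset.sum_congr rfl fun j _ => by rw [dz_cplx_eq_conj_dzbar hd, dzbar_cplx_enormSq]
  rw [e, Complex.normSq_eq_norm_sq]
  calc ‖∑ j, X j * (starRingEnd ℂ) (z j)‖ ^ 2 ≤ (∑ j, ‖X j‖ * ‖z j‖) ^ 2 := by
        gcongr
        refine (norm_sum_le _ _).trans_eq (Finset.sum_congr rfl fun j _ => ?_)
        rw [norm_mul, RCLike.norm_conj]
    _ ≤ (∑ j, ‖X j‖ ^ 2) * ∑ j, ‖z j‖ ^ 2 := Finset.sum_mul_sq_le_sq_mul_sq _ _ _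
    _ = enormSq X * enormSq z := by simp only [enormSq, Complex.normSq_eq_norm_sq]

end EuclideanNorm

section Weight

variable {n : ℕ} {Ω U V : Set (Fin n → ℂ)} {ρ : (Fin n → ℂ) → ℝ} {η ε : ℝ} {p : Fin n → ℂ}

theorem IsDefFn.mul (h : IsDefFn Ω V ρ) (hΩ : IsOpen Ω) {ψ : (Fin n → ℂ) → ℝ}
    (hψ : ContDiff ℝ (⊤ : ℕ∞) ψ) (hpos : ∀ z, 0 < ψ z) :
    IsDefFn Ω V fun z => ρ z * ψ z where
  isOpen := h.isOpen
  subset := h.subset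
  smooth := h.smooth.mul hψ.contDiffOn
  eq := by
    rw [h.eq]
    ext z
    simp only [mem_ofPred_eq, mul_neg_iff, hpos z, (hpos z).not_gt, and_true, and_false, false_or]
  grad_ne z hz := by
    rw [fderiv_fun_mul (h.differentiableAt (h.frontier_subset hz))
      (hψ.differentiable (by simp) z), h.eq_zero hΩ hz, zero_smul, zero_add]
    exact smul_ne_zero (hpos z).ne' (h.grad_ne z hz)

theorem eventually_forall_pos_of_mem_etaRhoSet (hΩ : IsOpen Ω) (hρ : IsDefFn Ω V ρ)
    (hps : ∀ p ∈ frontier Ω, LeviPseudoconvexAt ρ p) (hη : η ∈ etaRhoSet Ω U ρ) {a : ℝ}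
    (ha : η - 1 < a) (hε : 0 < ε) (hp : p ∈ frontier Ω) :
    ∀ᶠ z in 𝓝 p, 0 < ρ z → ∀ X : Fin n → ℂ, X ≠ 0 →
      0 < ρ z * (levi ρ X X z).re + a * normSq (dirDeriv X (cplx ρ) z) +
        ε * ρ z ^ 2 * enormSq X := by
  filter_upwards [(isCompact_sphere (0 : Fin n → ℂ) 1).eventually_forall_of_forall_eventually
    (x₀ := p) (P := fun z Y => 0 < ρ z → 0 < ρ z * (levi ρ Y Y z).re +
      a * normSq (dirDeriv Y (cplx ρ) z) + ε * ρ z ^ 2)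
    fun Y _ => eventually_pos_of_mem_etaRhoSet hΩ hρ hps hη ha hε hp] with z hz hpos X hX
  have hX0 : 0 < ‖X‖ := norm_pos_iff.2 hX
  have hY := hz (((‖X‖⁻¹ : ℝ) : ℂ) • X) (by
    rw [mem_sphere_zero_iff_norm, norm_smul, Complex.norm_real, norm_inv, norm_norm,
      inv_mul_cancel₀ hX0.ne']) hpos
  rw [levi_smul_smul, dirDeriv_smul, Complex.normSq_mul, Complex.normSq_ofReal, Complex.conj_ofReal,
    ← Complex.ofReal_mul, Complex.re_ofReal_mul] at hY
  have h1 := mul_pos (pow_pos hX0 2) hY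
  have e : ‖X‖ ^ 2 * (ρ z * (‖X‖⁻¹ * ‖X‖⁻¹ * (levi ρ X X z).re) +
      a * (‖X‖⁻¹ * ‖X‖⁻¹ * normSq (dirDeriv X (cplx ρ) z)) + ε * ρ z ^ 2) =
      ρ z * (levi ρ X X z).re + a * normSq (dirDeriv X (cplx ρ) z) + ε * ρ z ^ 2 * ‖X‖ ^ 2 := by
    field_simp
  rw [e] at h1
  have h2 : ε * ρ z ^ 2 * ‖X‖ ^ 2 ≤ ε * ρ z ^ 2 * enormSq X := by
    gcongr
    exact norm_sq_le_enormSq X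
  linarith

/-- The pointwise inequality behind strict plurisubharmonicity of `(ρ ψ) ^ η`. -/
theorem weighted_levi_pos {a δ C r ψ R s : ℝ} {d e : ℂ} (hδ : 0 < δ) (hε : 0 < ε)
    (ha : 0 < a) (hr : 0 < r) (hs : 0 < s) (hψ1 : 1 ≤ ψ) (hψ2 : ψ ≤ 2)
    (he : normSq e ≤ ε ^ 2 * (s * C)) (hC : (1 + a + δ) ^ 2 * ε * C ≤ δ / 2)
    (h : 0 < r * R + a * normSq d + ε / 4 * r ^ 2 * s) :
    0 < r * ψ * (r * (ε * s) + ψ * R + 2 * (d * (starRingEnd ℂ) e).re) +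
      (a + δ) * normSq ((r : ℂ) * e + (ψ : ℂ) * d) := by
  have e1 : normSq ((r : ℂ) * e + (ψ : ℂ) * d) =
      r ^ 2 * normSq e + 2 * r * ψ * (d * (starRingEnd ℂ) e).re + ψ ^ 2 * normSq d := by
    simp [Complex.normSq_apply]
    ring
  have e2 : normSq (((1 + a + δ) * r : ℝ) * e + ((δ * ψ : ℝ) : ℂ) * d) =
      ((1 + a + δ) * r) ^ 2 * normSq e + 2 * ((1 + a + δ) * r) * (δ * ψ) *
        (d * (starRingEnd ℂ) e).re + (δ * ψ) ^ 2 * normSq d := by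
    simp [Complex.normSq_apply]
    ring
  have h2 := Complex.normSq_nonneg (((1 + a + δ) * r : ℝ) * e + ((δ * ψ : ℝ) : ℂ) * d)
  rw [e2] at h2
  rw [e1]
  have he0 := Complex.normSq_nonneg e
  generalize normSq e = E at *
  generalize normSq d = D at *
  generalize (d * (starRingEnd ℂ) e).re = T at *
  have h3 : (1 + a + δ) ^ 2 * E ≤ δ * (ε * s / 2) := by
    calc (1 + a + δ) ^ 2 * E ≤ (1 + a + δ) ^ 2 * (ε ^ 2 * (s * C)) := by gcongr
      _ = (1 + a + δ) ^ 2 * ε * C * (ε * s) := by ring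
      _ ≤ δ / 2 * (ε * s) := by gcongr
      _ = δ * (ε * s / 2) := by ring
  have h4 : 0 ≤ r ^ 2 * (ε * s / 2) + 2 * (1 + a + δ) * r * ψ * T + δ * ψ ^ 2 * D := by
    refine (mul_nonneg_iff_of_pos_left hδ).1 (h2.trans ?_)
    have := mul_le_mul_of_nonneg_left h3 (sq_nonneg r)
    nlinarith
  have h5 : 0 < ψ ^ 2 * (r * R + a * D + ε / 4 * r ^ 2 * s) := by positivity
  have h6 : 0 ≤ r ^ 2 * (ε * s) * (ψ * (1 - ψ / 4) - 1 / 2) := by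
    have : 0 ≤ ψ * (1 - ψ / 4) - 1 / 2 := by nlinarith
    positivity
  have h7 : 0 ≤ (a + δ) * (r ^ 2 * E) := by positivity
  nlinarith

theorem exists_isDefFn_mem_steinExpSet (hΩ : IsOpen Ω) (hbd : Bornology.IsBounded Ω)
    (hρ : IsDefFn Ω V ρ) (hps : ∀ p ∈ frontier Ω, LeviPseudoconvexAt ρ p) {η' : ℝ}
    (hη : η ∈ etaRhoSet Ω U ρ) (hlt : η < η') :
    ∃ σ, IsDefFn Ω V σ ∧ η' ∈ steinExpSet Ω σ := by
  have hη1 : 0 < η - 1 := sub_pos.2 hη.1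
  obtain ⟨C, hC⟩ := hbd.isCompact_closure.bddAbove_image
    (contDiff_enormSq (n := n)).continuous.continuousOn
  replace hC : ∀ z ∈ closure Ω, enormSq z < |C| + 1 := fun z hz =>
    (hC (mem_image_of_mem _ hz)).trans_lt ((le_abs_self C).trans_lt (lt_add_one _))
  have hC0 : 0 < |C| + 1 := by positivity
  generalize |C| + 1 = C at *
  obtain ⟨a, ha, ha'⟩ : ∃ a, η - 1 < a ∧ a < η' - 1 := exists_between (by linarith)
  obtain ⟨δ, hδ, rfl⟩ : ∃ δ, 0 < δ ∧ η' = 1 + a + δ := ⟨η' - 1 - a, by linarith, by ring⟩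
  have ha0 : 0 < a := hη1.trans ha
  obtain ⟨ε, hε, hε1, hε2⟩ : ∃ ε, 0 < ε ∧ ε * C ≤ 1 ∧ (1 + a + δ) ^ 2 * ε * C ≤ δ / 2 := by
    refine ⟨min (1 / C) (δ / 2 / ((1 + a + δ) ^ 2 * C)), by positivity, ?_, ?_⟩
    · exact (le_div_iff₀ hC0).1 (min_le_left _ _)
    · have := (le_div_iff₀ (by positivity)).1
        (min_le_right (1 / C) (δ / 2 / ((1 + a + δ) ^ 2 * C)))
      linarith
  have hψs : ContDiff ℝ (⊤ : ℕ∞) fun z : Fin n → ℂ => 1 + ε * enormSq z :=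
    contDiff_const.add (contDiff_const.mul contDiff_enormSq)
  have hψ1 : ∀ z : Fin n → ℂ, 1 ≤ 1 + ε * enormSq z := fun z => by
    have := enormSq_nonneg z
    have : 0 ≤ ε * enormSq z := by positivity
    linarith
  refine ⟨_, hρ.mul hΩ hψs fun z => one_pos.trans_le (hψ1 z), by linarith,
    {z | ∀ᶠ w in 𝓝 z, w ∈ V ∧ fderiv ℝ ρ w ≠ 0 ∧ enormSq w < C ∧
      (0 < ρ w → ∀ X : Fin n → ℂ, X ≠ 0 → 0 < ρ w * (levi ρ X X w).re +
        a * normSq (dirDeriv X (cplx ρ) w) + ε / 4 * ρ w ^ 2 * enormSq X)},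
    isOpen_setOfPred_eventually_nhds, fun p hp => ?_, ?_⟩
  · have hpV := hρ.frontier_subset hp
    exact (hρ.isOpen.eventually_mem hpV).and
      (((((hρ.contDiffAt hpV).fderiv_right (m := (⊤ : ℕ∞)) (by simp)).continuousAt).eventually_ne
        (hρ.grad_ne p hp)).and ((contDiff_enormSq.continuous.continuousAt.eventually_lt_const
        (hC p (frontier_subset_closure hp))).and
        (eventually_forall_pos_of_mem_etaRhoSet hΩ hρ hps hη ha (by positivity) hp)))
  · rintro z ⟨hz, hzW⟩ X hX
    obtain ⟨hzV, hd, hzC, hpos⟩ := hzW.self_of_nhds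
    have hr := hρ.pos_of_notMem_closure hzV hz hd
    have h2 := hρ.contDiffAt_two hzV
    have hN2 : ContDiffAt ℝ 2 (enormSq : (Fin n → ℂ) → ℝ) z :=
      contDiff_enormSq.contDiffAt.of_le (WithTop.coe_le_coe.2 le_top)
    have hψ2 : ContDiffAt ℝ 2 (fun z : Fin n → ℂ => 1 + ε * enormSq z) z :=
      hψs.contDiffAt.of_le (WithTop.coe_le_coe.2 le_top)
    have hψd : ∀ w, fderiv ℝ (fun z : Fin n → ℂ => 1 + ε * enormSq z) w =
        ε • fderiv ℝ enormSq w := fun w => by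
      rw [fderiv_const_add, fderiv_const_mul (contDiff_enormSq.differentiable (by simp) w)]
    have hψX : dirDeriv X (cplx fun z => 1 + ε * enormSq z) z =
        ε * dirDeriv X (cplx enormSq) z := by
      rw [dirDeriv_cplx (hψ2.differentiableAt (by norm_num)),
        dirDeriv_cplx (hN2.differentiableAt (by norm_num)), hψd]
      simp
      ring
    have hψL : (levi (fun z => 1 + ε * enormSq z) X X z).re = ε * enormSq X := by
      have hψh : hess (fun z => 1 + ε * enormSq z) z = ε • hess enormSq z := by
        rw [hess, hess, funext hψd, fderiv_fun_const_smul hN2.hasFDerivAt_fderiv.differentiableAt]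
      rw [levi_self_re hψ2, hψh, smul_apply, smul_apply, smul_apply, smul_apply, smul_eq_mul,
        smul_eq_mul, ← mul_add, mul_div_assoc, ← levi_self_re hN2, levi_enormSq, Complex.ofReal_re]
    refine (levi_rpow_self_re_pos_iff (h2.mul hψ2)
      (mul_pos hr (one_pos.trans_le (hψ1 z))) (by linarith) X).2 ?_
    rw [levi_mul_self_re h2 hψ2, dirDeriv_cplx_mul (h2.differentiableAt (by norm_num))
      (hψ2.differentiableAt (by norm_num)), hψL, add_assoc 1 a, add_sub_cancel_left]
    refine weighted_levi_pos hδ hε ha0 hr (enormSq_pos hX) (hψ1 z) (C := C) ?_ ?_ ?_ (hpos hr X hX)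
    · nlinarith
    · rw [hψX, Complex.normSq_mul, Complex.normSq_ofReal]
      have := normSq_dirDeriv_enormSq_le X z
      have h3 : enormSq X * enormSq z ≤ enormSq X * C :=
        mul_le_mul_of_nonneg_left hzC.le (enormSq_nonneg X)
      nlinarith [mul_pos hε hε]
    · exact hε2

end Weight

/-- Theorem 3.1: the Steinness index equals the infimum over all smooth
defining functions `ρ` of `η_ρ`. -/
theorem steinIndex_eq_iInf_etaRho {n : ℕ} (hn : 2 ≤ n) (Ω : Set (Fin n → ℂ))
    (hΩ : IsOpen Ω) (hbd : Bornology.IsBounded Ω) (hpsc : IsPseudoconvex Ω)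
    (U : Set (Fin n → ℂ)) (hU : IsOpen U) (hfr : frontier Ω ⊆ U) :
    steinIndex Ω =
      ⨅ (V : Set (Fin n → ℂ)) (ρ : (Fin n → ℂ) → ℝ) (_ : IsDefFn Ω V ρ), etaRho Ω U ρ := by
  refine le_antisymm (le_iInf₂ fun V ρ => le_iInf fun hρ => le_sInf ?_)
    (iInf₂_mono fun V ρ => iInf_mono fun hρ =>
      sInf_le_sInf (image_mono (steinExpSet_subset_etaRhoSet hΩ hU hfr hρ)))
  rintro _ ⟨η, hη, rfl⟩
  obtain ⟨V', σ, hσ, hps⟩ := hpsc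
  refine ENNReal.le_of_forall_pos_le_add fun ε hε _ => ?_
  obtain ⟨τ, hτ, hmem⟩ := exists_isDefFn_mem_steinExpSet hΩ hbd hρ
    (fun p hp => LeviPseudoconvexAt.of_isDefFn hρ hσ hΩ hp (hps p hp)) hη
    (lt_add_of_pos_right η (NNReal.coe_pos.2 hε))
  calc steinIndex Ω ≤ steinExp Ω τ := iInf₂_le_of_le V τ (iInf_le _ hτ)
    _ ≤ ENNReal.ofReal (η + ε) := sInf_le (mem_image_of_mem _ hmem)
    _ ≤ ENNReal.ofReal η + ε := by
      rw [← ENNReal.ofReal_coe_nnreal (p := ε)]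
      exact ENNReal.ofReal_add_le
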